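/- arXiv:1310.3061 — 4 statements merged into one kernel-verified Lean document; each statement's English description precedes it below -/
import Mathlib

section
/- For all real constants c₁ > 0, b > 0 and every η with 0 < η < 1, one has lim_{T→0⁺} ∫₀^∞ exp(−c₁ T^{1−η} (u/b)^η) · (sin u)/u du = ∫₀^∞ (sin u)/u du = π/2. -/
open MeasureTheory Filter

lemma aux_abs_le_one (u : ℝ) : |Real.sin u / u| ≤ 1 := by
  by_cases h : u = 0
  · simp [h]
  · rw [← Real.sinc_of_ne_zero h]; exact Real.abs_sinc_le_one u

lemma aux_meas : Measurable (fun u : ℝ => Real.sin u / u) := by fun_prop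

lemma aux_intervalIntegrable (a b : ℝ) :
    IntervalIntegrable (fun u : ℝ => Real.sin u / u) volume a b := by
  refine (intervalIntegrable_const (c := (1:ℝ))).mono_fun aux_meas.aestronglyMeasurable ?_
  refine Eventually.of_forall fun u => ?_
  simpa [abs_div] using aux_abs_le_one u

lemma aux_inner (R t : ℝ) :
    ∫ u in (0:ℝ)..R, Real.exp (-u * t) * Real.sin u
      = (1 - Real.exp (-R * t) * (Real.cos R + t * Real.sin R)) * (1 + t ^ 2)⁻¹ := by
  have hne : (1 + t ^ 2) ≠ 0 := by positivity
  have hd : ∀ u ∈ Set.uIcc 0 R, HasDerivAt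
      (fun u : ℝ => -(Real.exp (-u * t) * (Real.cos u + t * Real.sin u)) * (1 + t ^ 2)⁻¹)
      (Real.exp (-u * t) * Real.sin u) u := by
    intro u _
    have h1 : HasDerivAt (fun u : ℝ => Real.exp (-u * t)) (Real.exp (-u * t) * (-1 * t)) u :=
      (((hasDerivAt_id u).neg).mul_const t).exp
    have h2 : HasDerivAt (fun u : ℝ => Real.cos u + t * Real.sin u)
        (-Real.sin u + t * Real.cos u) u :=
      (Real.hasDerivAt_cos u).add ((Real.hasDerivAt_sin u).const_mul t)
    have h3 := ((h1.mul h2).neg).mul_const (1 + t ^ 2)⁻¹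
    refine h3.congr_deriv ?_
    field_simp
    ring
  rw [intervalIntegral.integral_eq_sub_of_hasDerivAt hd
    (Continuous.intervalIntegrable (by fun_prop) _ _)]
  simp
  ring

lemma aux_dirichlet_eq (R : ℝ) (hR : 0 ≤ R) :
    ∫ u in (0:ℝ)..R, Real.sin u / u
      = ∫ t in Set.Ioi (0:ℝ),
        (1 - Real.exp (-R * t) * (Real.cos R + t * Real.sin R)) * (1 + t ^ 2)⁻¹ := by
  have h1 : ∀ u ∈ Set.Ioc 0 R,
      Real.sin u / u = ∫ t in Set.Ioi (0:ℝ), Real.exp (-u * t) * Real.sin u := by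
    intro u hu
    rw [integral_mul_const, integral_exp_mul_Ioi (by linarith [hu.1])]
    have := hu.1.ne'
    simp
    field_simp
  have hInt : Integrable (Function.uncurry fun u t : ℝ => Real.exp (-u * t) * Real.sin u)
      ((volume.restrict (Set.Ioc 0 R)).prod (volume.restrict (Set.Ioi 0))) := by
    rw [integrable_prod_iff
      (Continuous.aestronglyMeasurable (by unfold Function.uncurry; fun_prop))]
    constructor
    · refine (ae_restrict_iff' measurableSet_Ioc).2 (Eventually.of_forall fun u hu => ?_)
      have hneg : -u < 0 := by linarith [hu.1]
      exact (integrableOn_exp_mul_Ioi hneg 0).mul_const (Real.sin u)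
    · have : IntegrableOn (fun u : ℝ => |Real.sin u / u|) (Set.Ioc 0 R) :=
        ((intervalIntegrable_iff_integrableOn_Ioc_of_le hR).1 (aux_intervalIntegrable 0 R)).norm
      refine this.congr_fun (fun u hu => ?_) measurableSet_Ioc
      simp only [Function.uncurry, norm_mul, Real.norm_eq_abs, Real.abs_exp]
      rw [integral_mul_const, integral_exp_mul_Ioi (by linarith [hu.1])]
      have := hu.1
      have := hu.1.ne'
      rw [abs_div, abs_of_pos hu.1]
      simp
      field_simp
  rw [intervalIntegral.integral_of_le hR, setIntegral_congr_fun measurableSet_Ioc h1,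
    integral_integral_swap hInt]
  congr 1
  ext t
  rw [← intervalIntegral.integral_of_le hR, aux_inner]

lemma aux_dirichlet :
    Tendsto (fun R : ℝ => ∫ u in (0:ℝ)..R, Real.sin u / u) atTop (nhds (Real.pi / 2)) := by
  have hlim : Tendsto (fun R : ℝ => ∫ t in Set.Ioi (0:ℝ),
        (1 - Real.exp (-R * t) * (Real.cos R + t * Real.sin R)) * (1 + t ^ 2)⁻¹) atTop
      (nhds (∫ t in Set.Ioi (0:ℝ), (1 + t ^ 2)⁻¹)) := by
    have key : ∀ R t : ℝ, 0 < t →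
        |Real.exp (-R * t) * (Real.cos R + t * Real.sin R)| ≤ Real.exp (-R * t) * (1 + t) := by
      intro R t ht
      rw [abs_mul, Real.abs_exp]
      gcongr
      refine (abs_add_le _ _).trans ?_
      rw [abs_mul, abs_of_pos ht]
      nlinarith [Real.abs_cos_le_one R, Real.abs_sin_le_one R]
    refine tendsto_integral_filter_of_dominated_convergence (fun t => 2 * (1 + t ^ 2)⁻¹) ?_ ?_ ?_ ?_
    · refine Eventually.of_forall fun R => Measurable.aestronglyMeasurable (by fun_prop)
    · filter_upwards [eventually_ge_atTop 1] with R hR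
      refine (ae_restrict_iff' measurableSet_Ioi).2 (Eventually.of_forall fun t ht => ?_)
      have ht : 0 < t := ht
      have h0 : (0:ℝ) < (1 + t ^ 2)⁻¹ := by positivity
      rw [norm_mul, Real.norm_eq_abs, Real.norm_eq_abs, abs_of_pos h0]
      gcongr
      have h1 : Real.exp (-R * t) * (1 + t) ≤ 1 := by
        calc Real.exp (-R * t) * (1 + t) ≤ Real.exp (-t) * Real.exp t := by
              gcongr
              · nlinarith
              · linarith [Real.add_one_le_exp t]
          _ = 1 := by rw [← Real.exp_add]; simp
      have h2 := abs_le.1 ((key R t ht).trans h1)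
      rw [abs_le]
      constructor <;> linarith [h2.1, h2.2]
    · exact (integrable_inv_one_add_sq.integrableOn).const_mul 2
    · refine (ae_restrict_iff' measurableSet_Ioi).2 (Eventually.of_forall fun t ht => ?_)
      have ht : 0 < t := ht
      have he : Tendsto (fun R : ℝ => Real.exp (-R * t) * (1 + t)) atTop (nhds 0) := by
        have : Tendsto (fun R : ℝ => -R * t) atTop atBot :=
          tendsto_neg_atTop_atBot.atBot_mul_const ht
        simpa using (Real.tendsto_exp_atBot.comp this).mul_const (1 + t)
      have hz : Tendsto (fun R : ℝ => Real.exp (-R * t) * (Real.cos R + t * Real.sin R))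
          atTop (nhds 0) := squeeze_zero_norm (fun R => key R t ht) he
      simpa using (hz.const_sub 1).mul_const (1 + t ^ 2)⁻¹
  rw [integral_Ioi_inv_one_add_sq] at hlim
  simp only [Real.arctan_zero, sub_zero] at hlim
  refine hlim.congr' ?_
  filter_upwards [eventually_ge_atTop 0] with R hR
  exact (aux_dirichlet_eq R hR).symm

lemma aux_cont : Continuous (fun R : ℝ => ∫ u in (0:ℝ)..R, Real.sin u / u) :=
  intervalIntegral.continuous_primitive aux_intervalIntegrable 0

lemma aux_bound : ∃ C : ℝ, ∀ R : ℝ, 0 ≤ R → |∫ u in (0:ℝ)..R, Real.sin u / u| ≤ C := by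
  obtain ⟨A, hA⟩ := eventually_atTop.1
    ((aux_dirichlet.abs).eventually (gt_mem_nhds (lt_add_one |Real.pi / 2|)))
  obtain ⟨C, hC⟩ := (isCompact_Icc (a := (0:ℝ)) (b := A)).exists_bound_of_continuousOn
    aux_cont.continuousOn
  refine ⟨max C (|Real.pi / 2| + 1), fun R hR => ?_⟩
  rcases le_total R A with h | h
  · exact (hC R ⟨hR, h⟩).trans (le_max_left _ _)
  · exact (hA R h).le.trans (le_max_right _ _)

lemma aux_layer (k η : ℝ) (hk : 0 < k) (hη : 0 < η) :
    ∫ u in Set.Ioi (0:ℝ), Real.exp (-k * u ^ η) * (Real.sin u / u)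
      = ∫ v in Set.Ioi (0:ℝ), Real.exp (-v) *
          ∫ u in (0:ℝ)..((v / k) ^ (1 / η)), Real.sin u / u := by
  let F : ℝ → ℝ → ℝ := fun u v =>
    (Set.Ioi (k * u ^ η)).indicator (fun v => Real.exp (-v)) v * (Real.sin u / u)
  have hin : ∀ u ∈ Set.Ioi (0:ℝ),
      ∫ v in Set.Ioi (0:ℝ), (Set.Ioi (k * u ^ η)).indicator (fun v => Real.exp (-v)) v
        = Real.exp (-k * u ^ η) := by
    intro u hu
    have hu : 0 < u := hu
    have h0 : 0 ≤ k * u ^ η := by positivity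
    rw [setIntegral_indicator measurableSet_Ioi, Set.Ioi_inter_Ioi, sup_eq_right.2 h0,
      integral_exp_neg_Ioi, neg_mul]
  have hF : Measurable (Function.uncurry F) := by
    have : Function.uncurry F = fun p : ℝ × ℝ =>
        ({p : ℝ × ℝ | k * p.1 ^ η < p.2}.indicator (fun p => Real.exp (-p.2)) p)
          * (Real.sin p.1 / p.1) := by
      ext p; simp [F, Function.uncurry, Set.indicator]
    rw [this]
    refine Measurable.mul (Measurable.indicator (by fun_prop) ?_) (by fun_prop)
    exact measurableSet_lt (by fun_prop) (by fun_prop)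
  have hexp : IntegrableOn (fun u : ℝ => Real.exp (-k * u ^ η)) (Set.Ioi 0) := by
    simpa using integrableOn_rpow_mul_exp_neg_mul_rpow (s := 0) (by norm_num) hη hk
  have hInt : Integrable (Function.uncurry F)
      ((volume.restrict (Set.Ioi 0)).prod (volume.restrict (Set.Ioi 0))) := by
    rw [integrable_prod_iff hF.aestronglyMeasurable]
    constructor
    · refine Eventually.of_forall fun u => ?_
      have hi : Integrable ((Set.Ioi (k * u ^ η)).indicator (fun v => Real.exp (-v)))
          (volume.restrict (Set.Ioi 0)) :=
        (integrableOn_exp_neg_Ioi 0).indicator measurableSet_Ioi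
      exact hi.mul_const (Real.sin u / u)
    · have h1 : IntegrableOn (fun u : ℝ => Real.exp (-k * u ^ η) * |Real.sin u / u|)
          (Set.Ioi 0) := by
        refine Integrable.mono' hexp (Measurable.aestronglyMeasurable (by fun_prop)) ?_
        refine Eventually.of_forall fun u => ?_
        rw [norm_mul, Real.norm_eq_abs, Real.norm_eq_abs, abs_abs, Real.abs_exp]
        exact mul_le_of_le_one_right (Real.exp_pos _).le (aux_abs_le_one u)
      refine h1.congr_fun (fun u hu => ?_) measurableSet_Ioi
      simp only [Function.uncurry, F, norm_mul, Real.norm_eq_abs]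
      rw [integral_mul_const, ← hin u hu]
      congr 2
      ext v
      rw [abs_of_nonneg]
      exact Set.indicator_nonneg (fun v _ => (Real.exp_pos _).le) v
  have hL : ∫ u in Set.Ioi (0:ℝ), Real.exp (-k * u ^ η) * (Real.sin u / u)
      = ∫ u in Set.Ioi (0:ℝ), ∫ v in Set.Ioi (0:ℝ), F u v := by
    refine setIntegral_congr_fun measurableSet_Ioi fun u hu => ?_
    simp only [F]
    rw [integral_mul_const, hin u hu]
  rw [hL, integral_integral_swap hInt]
  refine setIntegral_congr_fun measurableSet_Ioi fun v hv => ?_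
  have hv : 0 < v := hv
  have hX : 0 ≤ (v / k) ^ (1 / η) := by positivity
  have hF2 : ∀ u ∈ Set.Ioi (0:ℝ), F u v =
      (Set.Iio ((v / k) ^ (1 / η))).indicator (fun u => Real.exp (-v) * (Real.sin u / u)) u := by
    intro u hu
    have hu : 0 < u := hu
    have hiff : k * u ^ η < v ↔ u < (v / k) ^ (1 / η) := by
      rw [one_div, Real.lt_rpow_inv_iff_of_pos hu.le (by positivity) hη, lt_div_iff₀ hk, mul_comm]
    by_cases h : k * u ^ η < v
    · simp only [F, Set.indicator, Set.mem_Ioi, Set.mem_Iio, if_pos h, if_pos (hiff.1 h)]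
    · have h' := h
      rw [hiff] at h'
      simp only [F, Set.indicator, Set.mem_Ioi, Set.mem_Iio, if_neg h, if_neg h', zero_mul]
  rw [setIntegral_congr_fun measurableSet_Ioi hF2, setIntegral_indicator measurableSet_Iio,
    Set.Ioi_inter_Iio, integral_const_mul, intervalIntegral.integral_of_le hX,
    integral_Ioc_eq_integral_Ioo]

lemma aux_limit (η : ℝ) (hη : 0 < η) :
    Tendsto (fun k : ℝ => ∫ u in Set.Ioi (0:ℝ), Real.exp (-k * u ^ η) * (Real.sin u / u))
      (nhdsWithin 0 (Set.Ioi 0)) (nhds (Real.pi / 2)) := by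
  obtain ⟨C, hC⟩ := aux_bound
  have hlim : Tendsto (fun k : ℝ => ∫ v in Set.Ioi (0:ℝ), Real.exp (-v) *
          ∫ u in (0:ℝ)..((v / k) ^ (1 / η)), Real.sin u / u)
      (nhdsWithin 0 (Set.Ioi 0))
      (nhds (∫ v in Set.Ioi (0:ℝ), Real.exp (-v) * (Real.pi / 2))) := by
    refine tendsto_integral_filter_of_dominated_convergence (fun v => Real.exp (-v) * C) ?_ ?_ ?_ ?_
    · refine Eventually.of_forall fun k => Measurable.aestronglyMeasurable ?_
      refine Measurable.mul (by fun_prop) ?_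
      exact aux_cont.measurable.comp (by fun_prop : Measurable fun v : ℝ => (v / k) ^ (1 / η))
    · filter_upwards [self_mem_nhdsWithin] with k hk
      have hk : 0 < k := hk
      refine (ae_restrict_iff' measurableSet_Ioi).2 (Eventually.of_forall fun v hv => ?_)
      have hv : 0 < v := hv
      rw [norm_mul, Real.norm_eq_abs, Real.abs_exp]
      gcongr
      exact hC _ (by positivity)
    · exact (integrableOn_exp_neg_Ioi 0).mul_const C
    · refine (ae_restrict_iff' measurableSet_Ioi).2 (Eventually.of_forall fun v hv => ?_)
      have hv : 0 < v := hv
      refine (aux_dirichlet.comp ?_).const_mul _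
      refine (tendsto_rpow_atTop (by positivity)).comp ?_
      have := (tendsto_inv_nhdsGT_zero (𝕜 := ℝ)).const_mul_atTop hv
      exact this.congr fun k => (div_eq_mul_inv v k).symm
  rw [integral_mul_const, integral_exp_neg_Ioi_zero, one_mul] at hlim
  refine hlim.congr' ?_
  filter_upwards [self_mem_nhdsWithin] with k hk
  exact (aux_layer k η hk hη).symm

/-- for `c₁, b > 0` and `0 < η < 1`,
`∫₀^∞ exp(−c₁ T^{1−η} (u/b)^η) (sin u)/u du → ∫₀^∞ (sin u)/u du = π/2` as `T → 0⁺`,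
where `∫₀^∞ (sin u)/u du` is the improper Riemann (Dirichlet) integral. -/
theorem sin_integral_limit_eta_lt_one
    (c₁ b η : ℝ) (hc₁ : 0 < c₁) (hb : 0 < b) (hη0 : 0 < η) (hη1 : η < 1) :
    Tendsto (fun T : ℝ =>
        ∫ u in Set.Ioi (0:ℝ), Real.exp (-c₁ * T ^ (1 - η) * (u / b) ^ η) * (Real.sin u / u))
      (nhdsWithin 0 (Set.Ioi 0)) (nhds (Real.pi / 2))
    ∧ Tendsto (fun R : ℝ => ∫ u in (0:ℝ)..R, Real.sin u / u) atTop (nhds (Real.pi / 2)) := by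
  refine ⟨?_, aux_dirichlet⟩
  have hk : Tendsto (fun T : ℝ => c₁ * T ^ (1 - η) / b ^ η) (nhdsWithin 0 (Set.Ioi 0))
      (nhdsWithin 0 (Set.Ioi 0)) := by
    refine tendsto_nhdsWithin_iff.2 ⟨?_, ?_⟩
    · have h1 : Tendsto (fun T : ℝ => T ^ (1 - η)) (nhds 0) (nhds ((0:ℝ) ^ (1 - η))) :=
        (Real.continuousAt_rpow_const 0 (1 - η) (Or.inr (by linarith))).tendsto
      rw [Real.zero_rpow (by linarith)] at h1
      simpa using ((h1.const_mul c₁).div_const (b ^ η)).mono_left nhdsWithin_le_nhds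
    · filter_upwards [self_mem_nhdsWithin] with T hT
      have hT : 0 < T := hT
      exact Set.mem_Ioi.2 (by positivity)
  refine ((aux_limit η hη0).comp hk).congr fun T => ?_
  refine setIntegral_congr_fun measurableSet_Ioi fun u hu => ?_
  have hu : 0 < u := hu
  simp only
  rw [Real.div_rpow hu.le hb.le]
  congr 2
  ring
end

section
/- Let σ > 0, ν > 0, θ ∈ ℝ, set Q(s) = 1 − θνs − (σ²ν/2)s² and s₊ = (−θν + √(2νσ² + ν²θ²))/(νσ²), and assume s₊ > 1. Fix a ∈ (1, s₊). For T > 0 define C(T) = (1/(2π)) ∫_{−∞}^{∞} Q(a+iy)^{−T/ν} · ((a+iy)(a+iy−1))⁻¹ dy, with Q(a+iy)^{−T/ν} taken in the principal branch. Then C(T) ∼ (T/ν)·log(s₊/(s₊ − 1)) as T → 0⁺, i.e. lim_{T→0⁺} C(T)·ν/(T·log(s₊/(s₊−1))) = 1. -/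
open MeasureTheory Filter


lemma vg_log_top (c d : ℝ) (hd : d ≠ 0) :
    Tendsto (fun y : ℝ => Complex.log ((c : ℂ) + (d * y : ℝ) * Complex.I) - (Real.log y : ℂ))
      atTop (nhds (Complex.log ((d : ℂ) * Complex.I))) := by
  have h1 : Tendsto (fun y : ℝ => Complex.log (((c / y : ℝ) : ℂ) + (d : ℂ) * Complex.I)) atTop
      (nhds (Complex.log ((d : ℂ) * Complex.I))) := by
    apply Tendsto.clog
    · have h2 : Tendsto (fun y : ℝ => c / y) atTop (nhds 0) := tendsto_const_nhds.div_atTop tendsto_id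
      have h3 := (Complex.continuous_ofReal.tendsto 0).comp h2
      simpa using h3.add_const ((d : ℂ) * Complex.I)
    · right
      simpa using hd
  refine h1.congr' ?_
  filter_upwards [eventually_gt_atTop 0] with y hy
  have h4 : (c : ℂ) + (d * y : ℝ) * Complex.I
      = (y : ℂ) * (((c / y : ℝ) : ℂ) + (d : ℂ) * Complex.I) := by
    have : (y : ℂ) ≠ 0 := by exact_mod_cast hy.ne'
    push_cast
    field_simp
  rw [h4, Complex.log_ofReal_mul hy]
  · ring
  · intro h
    have := congrArg Complex.im h
    simp at this
    exact hd this

lemma vg_norm_low (c d : ℝ) (y : ℝ) :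
    (min |c| |d|) / 2 * (1 + |y|) ≤ ‖(c : ℂ) + (d * y : ℝ) * Complex.I‖ := by
  have h1 := Complex.abs_re_le_norm ((c : ℂ) + (d * y : ℝ) * Complex.I)
  have h2 := Complex.abs_im_le_norm ((c : ℂ) + (d * y : ℝ) * Complex.I)
  simp only [Complex.add_re, Complex.add_im, Complex.mul_re, Complex.mul_im, Complex.ofReal_re,
    Complex.ofReal_im, Complex.I_re, Complex.I_im] at h1 h2
  ring_nf at h1 h2 ⊢
  rw [abs_mul] at h2
  have h3 := min_le_left |c| |d|
  have h4 := mul_le_mul_of_nonneg_right (min_le_right |c| |d|) (abs_nonneg y)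
  linarith

lemma vg_norm_up (c d : ℝ) (y : ℝ) :
    ‖(c : ℂ) + (d * y : ℝ) * Complex.I‖ ≤ (|c| + |d|) * (1 + |y|) := by
  have h1 := Complex.norm_le_abs_re_add_abs_im ((c : ℂ) + (d * y : ℝ) * Complex.I)
  simp only [Complex.add_re, Complex.add_im, Complex.mul_re, Complex.mul_im, Complex.ofReal_re,
    Complex.ofReal_im, Complex.I_re, Complex.I_im] at h1
  ring_nf at h1 ⊢
  rw [abs_mul] at h1
  have := abs_nonneg c
  have := abs_nonneg d
  have := mul_nonneg (abs_nonneg c) (abs_nonneg y)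
  linarith

lemma vg_integrable_pow (r : ℝ) (hr : 1 < r) :
    Integrable (fun y : ℝ => (1 + |y|) ^ (-r)) := by
  have := integrable_one_add_norm (E := ℝ) (μ := volume) (r := r) (by simpa using hr)
  simpa using this

/-- the shifted line never meets zero -/
lemma vg_ne (c d : ℝ) (hc : 0 < c) (y : ℝ) : (c : ℂ) + (d * y : ℝ) * Complex.I ≠ 0 := by
  intro h
  have := congrArg Complex.re h
  simp at this
  exact hc.ne' this

lemma vg_slit (c d : ℝ) (hc : 0 < c) (y : ℝ) :
    (c : ℂ) + (d * y : ℝ) * Complex.I ∈ Complex.slitPlane := by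
  left
  simpa using hc

lemma vg_cont (c d : ℝ) : Continuous fun y : ℝ => (c : ℂ) + (d * y : ℝ) * Complex.I := by
  fun_prop

lemma vg_int1 (c d c' d' : ℝ) (hc : 0 < c) (hc' : 0 < c') (hd : d ≠ 0) (hd' : d' ≠ 0) :
    Integrable (fun y : ℝ => 1 / (((c : ℂ) + (d * y : ℝ) * Complex.I)
      * ((c' : ℂ) + (d' * y : ℝ) * Complex.I))) := by
  have hm : 0 < (min |c| |d|) / 2 := by positivity
  have hm' : 0 < (min |c'| |d'|) / 2 := by positivity
  refine Integrable.mono' ((vg_integrable_pow 2 (by norm_num)).const_mul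
    (((min |c| |d|) / 2 * ((min |c'| |d'|) / 2))⁻¹)) ?_ ?_
  · apply Continuous.aestronglyMeasurable
    refine continuous_const.div₀ ((vg_cont c d).mul (vg_cont c' d')) fun y => ?_
    exact mul_ne_zero (vg_ne c d hc y) (vg_ne c' d' hc' y)
  · refine ae_of_all _ fun y => ?_
    have h1 := vg_norm_low c d y
    have h2 := vg_norm_low c' d' y
    have hy : 0 < 1 + |y| := by positivity
    rw [norm_div, norm_mul, norm_one, Real.rpow_neg hy.le, ← mul_inv, one_div]
    apply inv_anti₀ (by positivity)
    rw [Real.rpow_two]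
    calc _ = ((min |c| |d|) / 2 * (1 + |y|)) * ((min |c'| |d'|) / 2 * (1 + |y|)) := by ring
      _ ≤ _ := by gcongr

lemma vg_hasDeriv (c d : ℝ) (hc : 0 < c) (y : ℝ) :
    HasDerivAt (fun y : ℝ => Complex.log ((c : ℂ) + (d * y : ℝ) * Complex.I))
      ((d : ℂ) * Complex.I / ((c : ℂ) + (d * y : ℝ) * Complex.I)) y := by
  have h : HasDerivAt (fun y : ℝ => (c : ℂ) + (d * y : ℝ) * Complex.I) ((d : ℂ) * Complex.I) y := by
    have h0 : HasDerivAt (fun y : ℝ => d * y) d y := by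
      simpa using (hasDerivAt_id y).const_mul d
    exact (h0.ofReal_comp.mul_const Complex.I).const_add _
  exact h.clog_real (vg_slit c d hc y)

lemma vg_log_jump (d : ℝ) (hd : d ≠ 0) :
    Complex.log ((d : ℂ) * Complex.I) - Complex.log (((-d : ℝ) : ℂ) * Complex.I)
      = (Real.pi * SignType.sign d : ℝ) * Complex.I := by
  have hpos : ∀ e : ℝ, 0 < e → Complex.log ((e : ℂ) * Complex.I) -
      Complex.log (((-e : ℝ) : ℂ) * Complex.I) = Real.pi * Complex.I := by
    intro e he
    have : ((-e : ℝ) : ℂ) * Complex.I = (e : ℂ) * (-Complex.I) := by push_cast; ring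
    rw [this, Complex.log_ofReal_mul he Complex.I_ne_zero,
      Complex.log_ofReal_mul he (neg_ne_zero.2 Complex.I_ne_zero), Complex.log_I, Complex.log_neg_I]
    ring
  rcases lt_or_gt_of_ne hd with h | h
  · have := hpos (-d) (by linarith)
    rw [neg_neg] at this
    rw [sign_neg h, ← neg_sub, this]
    simp
  · rw [hpos d h, sign_pos h]; simp

lemma vg_J (a α β : ℝ) (ha : 1 < a) (hβ : β ≠ 0) (h1 : 0 < α + β * a) (h2 : α + β ≠ 0) :
    ∫ y : ℝ, (1 / ((((a - 1 : ℝ) : ℂ) + ((1 : ℝ) * y : ℝ) * Complex.I)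
      * (((α + β * a : ℝ) : ℂ) + (β * y : ℝ) * Complex.I)))
      = ((Real.pi * (1 - SignType.sign β) / (α + β) : ℝ) : ℂ) := by
  have ha' : 0 < a - 1 := by linarith
  have hc : ((α : ℂ) + β) ≠ 0 := by exact_mod_cast h2
  set G : ℝ → ℂ := fun y => (Complex.log (((a - 1 : ℝ) : ℂ) + ((1 : ℝ) * y : ℝ) * Complex.I)
    - Complex.log (((α + β * a : ℝ) : ℂ) + (β * y : ℝ) * Complex.I)) * (1 / (Complex.I * (α + β)))
    with hG
  have hder : ∀ y, HasDerivAt G (1 / ((((a - 1 : ℝ) : ℂ) + ((1 : ℝ) * y : ℝ) * Complex.I)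
      * (((α + β * a : ℝ) : ℂ) + (β * y : ℝ) * Complex.I))) y := by
    intro y
    have := ((vg_hasDeriv (a - 1) 1 ha' y).sub (vg_hasDeriv (α + β * a) β h1 y)).mul_const
      (1 / (Complex.I * (α + β)))
    refine HasDerivAt.congr_deriv this ?_
    have e1 := vg_ne (a - 1) 1 ha' y
    have e2 := vg_ne (α + β * a) β h1 y
    rw [div_sub_div _ _ e1 e2, div_mul_div_comm, div_eq_div_iff
      (mul_ne_zero (mul_ne_zero e1 e2) (mul_ne_zero Complex.I_ne_zero hc)) (mul_ne_zero e1 e2)]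
    push_cast
    ring
  have htop : Tendsto G atTop (nhds ((Complex.log (((1 : ℝ) : ℂ) * Complex.I) -
      Complex.log ((β : ℂ) * Complex.I)) * (1 / (Complex.I * (α + β))))) := by
    refine Tendsto.mul_const _ ?_
    refine ((vg_log_top (a - 1) 1 one_ne_zero).sub (vg_log_top (α + β * a) β hβ)).congr fun y => ?_
    ring
  have hbot : Tendsto G atBot (nhds ((Complex.log (((-1 : ℝ) : ℂ) * Complex.I) -
      Complex.log (((-β : ℝ) : ℂ) * Complex.I)) * (1 / (Complex.I * (α + β))))) := by
    refine Tendsto.mul_const _ ?_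
    have := ((vg_log_top (a - 1) (-1) (by norm_num)).sub
      (vg_log_top (α + β * a) (-β) (neg_ne_zero.2 hβ))).comp tendsto_neg_atBot_atTop
    refine this.congr fun y => ?_
    simp only [Function.comp]
    rw [neg_mul_neg, neg_mul_neg]
    ring
  rw [integral_of_hasDerivAt_of_tendsto hder (vg_int1 _ _ _ _ ha' h1 one_ne_zero hβ) hbot htop]
  have j1 := vg_log_jump 1 one_ne_zero
  have j2 := vg_log_jump β hβ
  rw [← sub_mul]
  have : (Complex.log (((1 : ℝ) : ℂ) * Complex.I) - Complex.log ((β : ℂ) * Complex.I)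
    - (Complex.log (((-1 : ℝ) : ℂ) * Complex.I) - Complex.log (((-β : ℝ) : ℂ) * Complex.I)))
    = (Real.pi * SignType.sign (1 : ℝ) : ℝ) * Complex.I
      - (Real.pi * SignType.sign β : ℝ) * Complex.I := by
    rw [← j1, ← j2]; ring
  rw [this, sign_one]
  have := Complex.I_ne_zero
  push_cast
  field_simp
  simp

/-- denominators occurring in the kernel -/
lemma vg_re_pos (a z t : ℝ) (hz : 0 < 1 + -z * a) (ht : t ∈ Set.Icc (0 : ℝ) 1) :
    min 1 (1 + -z * a) ≤ 1 + -(t * z) * a := by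
  have h1 : 1 + -(t * z) * a = (1 - t) * 1 + t * (1 + -z * a) := by ring
  rw [h1]
  have h2 := mul_le_mul_of_nonneg_left (min_le_left 1 (1 + -z * a)) (sub_nonneg.2 ht.2)
  have h3 := mul_le_mul_of_nonneg_left (min_le_right 1 (1 + -z * a)) ht.1
  linarith

lemma vg_kernel_integrable (a z : ℝ) (ha : 1 < a) (hz0 : z ≠ 0) (hz : 0 < 1 + -z * a) :
    Integrable (fun p : ℝ × ℝ => (-z : ℂ) *
      (1 / ((((a - 1 : ℝ) : ℂ) + ((1 : ℝ) * p.2 : ℝ) * Complex.I)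
      * (((1 + -(p.1 * z) * a : ℝ) : ℂ) + (-(p.1 * z) * p.2 : ℝ) * Complex.I))))
      ((volume.restrict (Set.Ioc (0 : ℝ) 1)).prod volume) := by
  have ha' : 0 < a - 1 := by linarith
  set δ := min 1 (1 + -z * a) with hδ
  have hδ0 : 0 < δ := lt_min one_pos hz
  set m := min δ |z| / 2 with hm
  have hm0 : 0 < m := by positivity
  set m' := min |a - 1| |(1 : ℝ)| / 2 with hm'
  have hm0' : 0 < m' := by positivity
  apply Integrable.const_mul
  have hi1 : Integrable (fun t : ℝ => t ^ (-(1 / 2) : ℝ)) (volume.restrict (Set.Ioc (0 : ℝ) 1)) := by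
    have := (intervalIntegral.intervalIntegrable_rpow' (a := 0) (b := 1)
      (r := -(1 / 2)) (by norm_num))
    exact (intervalIntegrable_iff_integrableOn_Ioc_of_le zero_le_one).1 this
  have hi2 := vg_integrable_pow (3 / 2) (by norm_num)
  refine Integrable.mono' ((hi1.mul_prod hi2).const_mul ((m' * m)⁻¹)) ?_ ?_
  · apply Measurable.aestronglyMeasurable
    fun_prop
  · have hae : ∀ᵐ p : ℝ × ℝ ∂((volume.restrict (Set.Ioc (0 : ℝ) 1)).prod volume),
        p.1 ∈ Set.Ioc (0 : ℝ) 1 :=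
      Measure.quasiMeasurePreserving_fst.ae (ae_restrict_mem measurableSet_Ioc)
    filter_upwards [hae] with p hp
    obtain ⟨t, y⟩ := p
    simp only at hp ⊢
    have ht0 : 0 < t := hp.1
    have hy : 0 < 1 + |y| := by positivity
    have h1 := vg_norm_low (a - 1) 1 y
    have h2 : m * (1 + t * |y|) ≤
        ‖(((1 + -(t * z) * a : ℝ) : ℂ) + (-(t * z) * y : ℝ) * Complex.I)‖ := by
      have e1 := Complex.re_le_norm (((1 + -(t * z) * a : ℝ) : ℂ) + (-(t * z) * y : ℝ) * Complex.I)
      have e2 := Complex.abs_im_le_norm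
        (((1 + -(t * z) * a : ℝ) : ℂ) + (-(t * z) * y : ℝ) * Complex.I)
      simp only [Complex.add_re, Complex.add_im, Complex.mul_re, Complex.mul_im, Complex.ofReal_re,
        Complex.ofReal_im, Complex.I_re, Complex.I_im, mul_zero, mul_one, sub_zero, add_zero,
        zero_add] at e1 e2
      have e3 := vg_re_pos a z t hz ⟨ht0.le, hp.2⟩
      rw [abs_mul, abs_neg, abs_mul, abs_of_pos ht0] at e2
      have e4 := min_le_left δ |z|
      have e5 := mul_le_mul_of_nonneg_right (min_le_right δ |z|)
        (mul_nonneg ht0.le (abs_nonneg y))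
      rw [← hδ] at e3
      have : m * (1 + t * |y|) = (min δ |z| + min δ |z| * (t * |y|)) / 2 := by rw [hm]; ring
      rw [this]
      linarith
    have h3 : t ^ (1 / 2 : ℝ) * (1 + |y|) ^ (1 / 2 : ℝ) ≤ 1 + t * |y| := by
      rw [← Real.mul_rpow ht0.le hy.le, ← Real.sqrt_eq_rpow]
      apply Real.sqrt_le_iff.2
      have : 0 ≤ t * |y| := by positivity
      refine ⟨by linarith, ?_⟩
      nlinarith [hp.2]
    have h4 : (1 + |y|) ^ (3 / 2 : ℝ) = (1 + |y|) * (1 + |y|) ^ (1 / 2 : ℝ) := by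
      rw [show (3 / 2 : ℝ) = 1 + 1 / 2 by norm_num, Real.rpow_add hy, Real.rpow_one]
    have p1 : 0 < t ^ (1 / 2 : ℝ) := Real.rpow_pos_of_pos ht0 _
    have p2 : 0 < (1 + |y|) ^ (1 / 2 : ℝ) := Real.rpow_pos_of_pos hy _
    rw [norm_div, norm_mul, norm_one, Real.rpow_neg hy.le, Real.rpow_neg ht0.le, ← mul_inv,
      ← mul_inv, one_div, h4]
    apply inv_anti₀ (by positivity)
    calc m' * m * (t ^ (1 / 2 : ℝ) * ((1 + |y|) * (1 + |y|) ^ (1 / 2 : ℝ)))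
        = (m' * (1 + |y|)) * (m * (t ^ (1 / 2 : ℝ) * (1 + |y|) ^ (1 / 2 : ℝ))) := by ring
      _ ≤ (m' * (1 + |y|)) * (m * (1 + t * |y|)) := by gcongr
      _ ≤ _ := by gcongr

lemma vg_log_repr (a z y : ℝ) (ha : 1 < a) (hz : 0 < 1 + -z * a) :
    Complex.log (((1 + -z * a : ℝ) : ℂ) + (-z * y : ℝ) * Complex.I) /
      (((a : ℂ) + ((1 : ℝ) * y : ℝ) * Complex.I) *
        (((a - 1 : ℝ) : ℂ) + ((1 : ℝ) * y : ℝ) * Complex.I)) =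
    ∫ t in Set.Ioc (0 : ℝ) 1, (-z : ℂ) *
      (1 / ((((a - 1 : ℝ) : ℂ) + ((1 : ℝ) * y : ℝ) * Complex.I)
      * (((1 + -(t * z) * a : ℝ) : ℂ) + (-(t * z) * y : ℝ) * Complex.I))) := by
  have n1 := vg_ne a 1 (by linarith) y
  have n2 := vg_ne (a - 1) 1 (by linarith) y
  have hpos : ∀ t ∈ Set.uIcc (0 : ℝ) 1, 0 < 1 + -(t * z) * a := by
    intro t ht
    rw [Set.uIcc_of_le zero_le_one] at ht
    exact lt_of_lt_of_le (lt_min one_pos hz) (vg_re_pos a z t hz ht)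
  rw [← intervalIntegral.integral_of_le zero_le_one]
  rw [intervalIntegral.integral_eq_sub_of_hasDerivAt (f := fun t : ℝ =>
    Complex.log (((1 + -(t * z) * a : ℝ) : ℂ) + (-(t * z) * y : ℝ) * Complex.I) /
      (((a : ℂ) + ((1 : ℝ) * y : ℝ) * Complex.I) *
        (((a - 1 : ℝ) : ℂ) + ((1 : ℝ) * y : ℝ) * Complex.I)))]
  · simp
  · intro t ht
    have hd : HasDerivAt (fun t : ℝ =>
        ((1 + -(t * z) * a : ℝ) : ℂ) + (-(t * z) * y : ℝ) * Complex.I)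
        (((-z * a : ℝ) : ℂ) + ((-z * y : ℝ) : ℂ) * Complex.I) t := by
      have h0 : HasDerivAt (fun t : ℝ => -(t * z)) (-z) t := by
        simpa using ((hasDerivAt_id t).mul_const z).fun_neg
      exact ((h0.mul_const a).const_add 1).ofReal_comp.add
        ((h0.mul_const y).ofReal_comp.mul_const Complex.I)
    have := (hd.clog_real (vg_slit (1 + -(t * z) * a) (-(t * z)) (hpos t ht) y)).div_const
      (((a : ℂ) + ((1 : ℝ) * y : ℝ) * Complex.I) *
        (((a - 1 : ℝ) : ℂ) + ((1 : ℝ) * y : ℝ) * Complex.I))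
    refine HasDerivAt.congr_deriv this ?_
    have n3 := vg_ne (1 + -(t * z) * a) (-(t * z)) (hpos t ht) y
    rw [div_div, mul_one_div, div_eq_div_iff (mul_ne_zero n3 (mul_ne_zero n1 n2))
      (mul_ne_zero n2 n3)]
    push_cast
    ring
  · apply ContinuousOn.intervalIntegrable
    apply ContinuousOn.mul continuousOn_const
    apply ContinuousOn.div₀ continuousOn_const
    · fun_prop
    · intro t ht
      exact mul_ne_zero n2 (vg_ne (1 + -(t * z) * a) (-(t * z)) (hpos t ht) y)

lemma vg_K (a z : ℝ) (ha : 1 < a) (hz0 : z ≠ 0) (hz : 0 < 1 + -z * a) :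
    Integrable (fun y : ℝ => Complex.log (((1 + -z * a : ℝ) : ℂ) + (-z * y : ℝ) * Complex.I) /
      (((a : ℂ) + ((1 : ℝ) * y : ℝ) * Complex.I) *
        (((a - 1 : ℝ) : ℂ) + ((1 : ℝ) * y : ℝ) * Complex.I))) ∧
    ∫ y : ℝ, Complex.log (((1 + -z * a : ℝ) : ℂ) + (-z * y : ℝ) * Complex.I) /
      (((a : ℂ) + ((1 : ℝ) * y : ℝ) * Complex.I) *
        (((a - 1 : ℝ) : ℂ) + ((1 : ℝ) * y : ℝ) * Complex.I)) =
      ((Real.pi * (1 + SignType.sign z) * Real.log (1 - z) : ℝ) : ℂ) := by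
  have hI := vg_kernel_integrable a z ha hz0 hz
  simp only [vg_log_repr a z _ ha hz]
  refine ⟨hI.integral_prod_right, ?_⟩
  rw [← integral_integral_swap (f := fun t y : ℝ => (-z : ℂ) *
      (1 / ((((a - 1 : ℝ) : ℂ) + ((1 : ℝ) * y : ℝ) * Complex.I)
      * (((1 + -(t * z) * a : ℝ) : ℂ) + (-(t * z) * y : ℝ) * Complex.I)))) hI]
  have hpos1 : ∀ t ∈ Set.Icc (0 : ℝ) 1, 0 < 1 - t * z := by
    intro t ht
    rcases le_or_gt z 0 with h | h
    · nlinarith [mul_nonneg ht.1 (neg_nonneg.2 h)]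
    · nlinarith [mul_le_mul_of_nonneg_right ht.2 h.le]
  have hin : ∀ t ∈ Set.Ioc (0 : ℝ) 1, (∫ y : ℝ, (-z : ℂ) *
      (1 / ((((a - 1 : ℝ) : ℂ) + ((1 : ℝ) * y : ℝ) * Complex.I)
      * (((1 + -(t * z) * a : ℝ) : ℂ) + (-(t * z) * y : ℝ) * Complex.I)))) =
      ((Real.pi * (1 + SignType.sign z) * (-z / (1 - t * z)) : ℝ) : ℂ) := by
    intro t ht
    have p1 := hpos1 t ⟨ht.1.le, ht.2⟩
    rw [integral_const_mul, vg_J a 1 (-(t * z)) ha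
      (neg_ne_zero.2 (mul_ne_zero ht.1.ne' hz0))
      (lt_of_lt_of_le (lt_min one_pos hz) (vg_re_pos a z t hz ⟨ht.1.le, ht.2⟩)) (by linarith)]
    rw [Left.sign_neg, sign_mul, sign_pos ht.1, one_mul]
    rw [← Complex.ofReal_neg, ← Complex.ofReal_mul]
    congr 1
    simp only [SignType.coe_neg]
    ring
  rw [setIntegral_congr_fun measurableSet_Ioc hin, integral_complex_ofReal,
    integral_const_mul, ← intervalIntegral.integral_of_le zero_le_one]
  congr 2
  rw [intervalIntegral.integral_eq_sub_of_hasDerivAt (f := fun t : ℝ => Real.log (1 - t * z))]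
  · simp
  · intro t ht
    rw [Set.uIcc_of_le zero_le_one] at ht
    have : HasDerivAt (fun t : ℝ => 1 - t * z) (-z) t := by
      simpa using ((hasDerivAt_id t).mul_const z).const_sub 1
    exact this.log (hpos1 t ht).ne'
  · apply ContinuousOn.intervalIntegrable
    apply ContinuousOn.div₀ continuousOn_const
    · fun_prop
    · intro t ht
      rw [Set.uIcc_of_le zero_le_one] at ht
      exact (hpos1 t ht).ne'

lemma vg_log_bound (c d : ℝ) (hc : 0 < c) (hd : d ≠ 0) :
    ∃ K : ℝ, ∀ y : ℝ, ‖Complex.log ((c : ℂ) + (d * y : ℝ) * Complex.I)‖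
      ≤ K + Real.log (1 + |y|) := by
  set m := (min |c| |d|) / 2 with hm
  have hm0 : 0 < m := by positivity
  set M := |c| + |d| with hM
  have hM0 : 0 < M := by positivity
  refine ⟨|Real.log m| + |Real.log M| + Real.pi, fun y => ?_⟩
  have hy : 0 < 1 + |y| := by positivity
  have hy1 : 0 ≤ Real.log (1 + |y|) := Real.log_nonneg (by linarith [abs_nonneg y])
  have h1 := Real.log_le_log (by positivity) (vg_norm_low c d y)
  have h2 := Real.log_le_log (norm_pos_iff.2 (vg_ne c d hc y)) (vg_norm_up c d y)
  rw [Real.log_mul hm0.ne' hy.ne'] at h1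
  rw [Real.log_mul hM0.ne' hy.ne'] at h2
  have h3 := Complex.norm_le_abs_re_add_abs_im (Complex.log ((c : ℂ) + (d * y : ℝ) * Complex.I))
  rw [Complex.log_re, Complex.log_im] at h3
  have h4 := Complex.abs_arg_le_pi ((c : ℂ) + (d * y : ℝ) * Complex.I)
  have h5 : |Real.log ‖(c : ℂ) + (d * y : ℝ) * Complex.I‖| ≤
      |Real.log m| + |Real.log M| + Real.log (1 + |y|) := by
    rw [abs_le]
    constructor
    · linarith [neg_abs_le (Real.log m), abs_nonneg (Real.log M)]
    · linarith [le_abs_self (Real.log M), abs_nonneg (Real.log m)]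
  linarith

lemma vg_deriv (a z w ν : ℝ) (ha : 1 < a) (hz0 : z ≠ 0) (hz : 0 < 1 + -z * a)
    (hw0 : w ≠ 0) (hw : 0 < 1 + -w * a) (hν : 0 < ν) :
    HasDerivAt (fun T : ℝ => ∫ y : ℝ, Complex.exp ((T : ℂ) * (-(1 / (ν : ℂ)) *
        (Complex.log (((1 + -z * a : ℝ) : ℂ) + (-z * y : ℝ) * Complex.I) +
          Complex.log (((1 + -w * a : ℝ) : ℂ) + (-w * y : ℝ) * Complex.I)))) *
        (1 / (((a : ℂ) + ((1 : ℝ) * y : ℝ) * Complex.I) *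
        (((a - 1 : ℝ) : ℂ) + ((1 : ℝ) * y : ℝ) * Complex.I))))
      (-(1 / (ν : ℂ)) * ((Real.pi * (1 + SignType.sign z) * Real.log (1 - z) : ℝ) +
        (Real.pi * (1 + SignType.sign w) * Real.log (1 - w) : ℝ))) 0 := by
  have ha' : 0 < a - 1 := by linarith
  have ha0 : 0 < a := by linarith
  obtain ⟨K1, hK1⟩ := vg_log_bound (1 + -z * a) (-z) hz (neg_ne_zero.2 hz0)
  obtain ⟨K2, hK2⟩ := vg_log_bound (1 + -w * a) (-w) hw (neg_ne_zero.2 hw0)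
  set L : ℝ → ℂ := fun y => Complex.log (((1 + -z * a : ℝ) : ℂ) + (-z * y : ℝ) * Complex.I) +
          Complex.log (((1 + -w * a : ℝ) : ℂ) + (-w * y : ℝ) * Complex.I) with hL
  set D : ℝ → ℂ := fun y => 1 / (((a : ℂ) + ((1 : ℝ) * y : ℝ) * Complex.I) *
        (((a - 1 : ℝ) : ℂ) + ((1 : ℝ) * y : ℝ) * Complex.I)) with hD
  have hLc : Continuous L := by
    rw [continuous_iff_continuousAt]
    intro y
    exact ((vg_hasDeriv _ _ hz y).continuousAt).add ((vg_hasDeriv _ _ hw y).continuousAt)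
  have hDi : Integrable D := vg_int1 a 1 (a - 1) 1 ha0 ha' one_ne_zero one_ne_zero
  have hDm := hDi.aestronglyMeasurable
  have hLb : ∀ y, ‖L y‖ ≤ (K1 + K2) + 2 * Real.log (1 + |y|) := by
    intro y
    have := norm_add_le (Complex.log (((1 + -z * a : ℝ) : ℂ) + (-z * y : ℝ) * Complex.I))
      (Complex.log (((1 + -w * a : ℝ) : ℂ) + (-w * y : ℝ) * Complex.I))
    linarith [hK1 y, hK2 y]
  set m := (min |a| |(1 : ℝ)|) / 2 with hm
  have hm0 : 0 < m := by positivity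
  set m' := (min |a - 1| |(1 : ℝ)|) / 2 with hm'
  have hm0' : 0 < m' := by positivity
  have hDb : ∀ y, ‖D y‖ ≤ (m * m')⁻¹ * (1 + |y|) ^ (-2 : ℝ) := by
    intro y
    have h1 := vg_norm_low a 1 y
    have h2 := vg_norm_low (a - 1) 1 y
    have hy : 0 < 1 + |y| := by positivity
    rw [hD]
    simp only
    rw [norm_div, norm_mul, norm_one, Real.rpow_neg hy.le, ← mul_inv, one_div]
    apply inv_anti₀ (by positivity)
    rw [Real.rpow_two]
    calc _ = (m * (1 + |y|)) * (m' * (1 + |y|)) := by ring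
      _ ≤ _ := by gcongr
  have key := hasDerivAt_integral_of_dominated_loc_of_deriv_le (μ := (volume : Measure ℝ))
    (F := fun (T : ℝ) (y : ℝ) => Complex.exp ((T : ℂ) * (-(1 / (ν : ℂ)) * L y)) * D y)
    (F' := fun (T : ℝ) (y : ℝ) => Complex.exp ((T : ℂ) * (-(1 / (ν : ℂ)) * L y)) *
      (-(1 / (ν : ℂ)) * L y) * D y) (x₀ := 0) (s := Metric.ball 0 (ν / 8))
    (bound := fun y => (8 / ν * Real.exp ((K1 + K2) / 4) * (m * m')⁻¹) * (1 + |y|) ^ (-(3 / 2) : ℝ))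
    (Metric.ball_mem_nhds _ (by positivity)) ?_ ?_ ?_ ?_ ?_ ?_
  · refine key.2.congr_deriv ?_
    obtain ⟨i1, e1⟩ := vg_K a z ha hz0 hz
    obtain ⟨i2, e2⟩ := vg_K a w ha hw0 hw
    rw [← e1, ← e2, ← integral_add i1 i2, ← integral_const_mul]
    congr 1
    ext y
    simp only [hL, hD, Complex.ofReal_zero, zero_mul, Complex.exp_zero]
    ring
  · refine Eventually.of_forall fun T => ?_
    refine AEStronglyMeasurable.mul ?_ hDm
    exact (Complex.continuous_exp.comp (continuous_const.mul
      (continuous_const.mul hLc))).aestronglyMeasurable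
  · simpa using hDi
  · refine AEStronglyMeasurable.mul ?_ hDm
    exact ((Complex.continuous_exp.comp (continuous_const.mul
      (continuous_const.mul hLc))).mul (continuous_const.mul hLc)).aestronglyMeasurable
  · refine ae_of_all _ fun y T hT => ?_
    have hT' : |T| < ν / 8 := by simpa using hT
    have hy : 0 < 1 + |y| := by positivity
    have b1 : ‖Complex.exp ((T : ℂ) * (-(1 / (ν : ℂ)) * L y))‖ ≤ Real.exp (‖L y‖ / 8) := by
      refine (Complex.norm_exp_le_exp_norm _).trans (Real.exp_le_exp.2 ?_)
      rw [norm_mul, norm_mul, norm_neg, norm_div, norm_one, Complex.norm_real, Complex.norm_real,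
        Real.norm_eq_abs, Real.norm_eq_abs, abs_of_pos hν, ← mul_assoc]
      have : |T| * (1 / ν) ≤ 1 / 8 := by
        rw [mul_one_div, div_le_iff₀ hν]; linarith
      nlinarith [norm_nonneg (L y)]
    have b2 : ‖L y‖ ≤ 8 * Real.exp (‖L y‖ / 8) := by
      have := Real.add_one_le_exp (‖L y‖ / 8)
      linarith
    have b3 : ‖-(1 / (ν : ℂ)) * L y‖ = 1 / ν * ‖L y‖ := by
      rw [norm_mul, norm_neg, norm_div, norm_one, Complex.norm_real, Real.norm_eq_abs,
        abs_of_pos hν]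
    have b4 : Real.exp (‖L y‖ / 8) * Real.exp (‖L y‖ / 8) ≤
        Real.exp ((K1 + K2) / 4) * (1 + |y|) ^ (1 / 2 : ℝ) := by
      rw [← Real.exp_add, Real.rpow_def_of_pos hy, ← Real.exp_add, Real.exp_le_exp]
      linarith [hLb y]
    have b5 : (1 + |y|) ^ (1 / 2 : ℝ) * (1 + |y|) ^ (-2 : ℝ) = (1 + |y|) ^ (-(3 / 2) : ℝ) := by
      rw [← Real.rpow_add hy]; norm_num
    rw [norm_mul, norm_mul, b3]
    calc _ ≤ Real.exp (‖L y‖ / 8) * (1 / ν * (8 * Real.exp (‖L y‖ / 8))) *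
          ((m * m')⁻¹ * (1 + |y|) ^ (-2 : ℝ)) := by
            gcongr
            exact hDb y
      _ = (8 / ν * (Real.exp (‖L y‖ / 8) * Real.exp (‖L y‖ / 8))) *
          ((m * m')⁻¹ * (1 + |y|) ^ (-2 : ℝ)) := by ring
      _ ≤ (8 / ν * (Real.exp ((K1 + K2) / 4) * (1 + |y|) ^ (1 / 2 : ℝ))) *
          ((m * m')⁻¹ * (1 + |y|) ^ (-2 : ℝ)) := by gcongr
      _ = _ := by rw [← b5]; ring
  · exact (vg_integrable_pow (3 / 2) (by norm_num)).const_mul _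
  · refine ae_of_all _ fun y T _ => ?_
    have h0 : HasDerivAt (fun T : ℝ => (T : ℂ) * (-(1 / (ν : ℂ)) * L y))
        (-(1 / (ν : ℂ)) * L y) T := by
      simpa using (Complex.ofRealCLM.hasDerivAt (x := T)).mul_const (-(1 / (ν : ℂ)) * L y)
    exact h0.cexp.mul_const _

/-- small-maturity ATM call price asymptotics in the variance gamma
model with zero drift: `C(T) ∼ (T/ν) log(s₊/(s₊−1))` as `T → 0⁺`, where
`C(T) = (1/(2π)) ∫ Q(a+iy)^{−T/ν} / ((a+iy)(a+iy−1)) dy` with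
`Q(s) = 1 − θνs − (σ²ν/2)s²`. -/
theorem variance_gamma_atm_call_asymptotics
    (σ ν θ : ℝ) (hσ : 0 < σ) (hν : 0 < ν)
    (sp : ℝ) (hsp : sp = (-(θ * ν) + Real.sqrt (2 * ν * σ ^ 2 + ν ^ 2 * θ ^ 2)) / (ν * σ ^ 2))
    (hsp1 : 1 < sp)
    (a : ℝ) (ha : a ∈ Set.Ioo 1 sp)
    (Cp : ℝ → ℂ)
    (hCp : ∀ T : ℝ, 0 < T → Cp T = (1 / (2 * Real.pi) : ℂ) *
      ∫ y : ℝ, (1 - ((θ * ν : ℝ) : ℂ) * ((a : ℂ) + y * Complex.I)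
            - ((σ ^ 2 * ν / 2 : ℝ) : ℂ) * ((a : ℂ) + y * Complex.I) ^ 2) ^ (-(T : ℂ) / (ν : ℂ))
        / (((a : ℂ) + y * Complex.I) * ((a : ℂ) + y * Complex.I - 1))) :
    Tendsto (fun T : ℝ => Cp T * ((ν / (T * Real.log (sp / (sp - 1))) : ℝ) : ℂ))
      (nhdsWithin 0 (Set.Ioi 0)) (nhds 1) := by
  obtain ⟨ha1, hasp⟩ := ha
  have hsp0 : 0 < sp := by linarith
  set κ := σ ^ 2 * ν / 2 with hκ
  have hκ0 : 0 < κ := by positivity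
  have hroot : θ * ν = 1 / sp - κ * sp := by
    have hs := Real.sq_sqrt (show (0 : ℝ) ≤ 2 * ν * σ ^ 2 + ν ^ 2 * θ ^ 2 by positivity)
    have h1 : Real.sqrt (2 * ν * σ ^ 2 + ν ^ 2 * θ ^ 2) = sp * (ν * σ ^ 2) + θ * ν := by
      rw [hsp]; field_simp; ring
    rw [h1] at hs
    have h2 : (ν * σ ^ 2) * (θ * ν * sp) = (ν * σ ^ 2) * (1 - κ * sp ^ 2) := by
      rw [hκ]; linear_combination hs / 2
    have h3 : θ * ν * sp = 1 - κ * sp ^ 2 := mul_left_cancel₀ (by positivity) h2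
    field_simp
    linarith
  have hz : 0 < 1 + -(1 / sp) * a := by
    have : 1 / sp * a < 1 := by rw [one_div_mul_eq_div, div_lt_one hsp0]; exact hasp
    linarith
  have hw : 0 < 1 + -(-(κ * sp)) * a := by
    rw [neg_neg]; positivity
  have hz0 : 1 / sp ≠ 0 := by positivity
  have hw0 : -(κ * sp) ≠ 0 := neg_ne_zero.2 (by positivity)
  have hd := vg_deriv a (1 / sp) (-(κ * sp)) ν ha1 hz0 hz hw0 hw hν
  set F : ℝ → ℂ := fun T : ℝ => ∫ y : ℝ, Complex.exp ((T : ℂ) * (-(1 / (ν : ℂ)) *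
        (Complex.log (((1 + -(1 / sp) * a : ℝ) : ℂ) + (-(1 / sp) * y : ℝ) * Complex.I) +
          Complex.log (((1 + -(-(κ * sp)) * a : ℝ) : ℂ) + (-(-(κ * sp)) * y : ℝ) * Complex.I)))) *
        (1 / (((a : ℂ) + ((1 : ℝ) * y : ℝ) * Complex.I) *
        (((a - 1 : ℝ) : ℂ) + ((1 : ℝ) * y : ℝ) * Complex.I))) with hF
  have hF0 : F 0 = 0 := by
    have := vg_J a 0 1 ha1 one_ne_zero (by linarith) (by norm_num)
    rw [sign_one] at this
    simp only [hF, Complex.ofReal_zero, zero_mul, Complex.exp_zero, one_mul]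
    simp only [zero_add, one_mul, SignType.coe_one, sub_self, mul_zero, zero_div,
      Complex.ofReal_zero] at this
    rw [← this]
    congr 1
    ext y
    rw [mul_comm]
  have hFC : ∀ T : ℝ, 0 < T → Cp T = (1 / (2 * Real.pi) : ℂ) * F T := by
    intro T hT
    rw [hCp T hT]
    congr 2
    ext y
    set A := (((1 + -(1 / sp) * a : ℝ) : ℂ) + (-(1 / sp) * y : ℝ) * Complex.I) with hA
    set B := (((1 + -(-(κ * sp)) * a : ℝ) : ℂ) + (-(-(κ * sp)) * y : ℝ) * Complex.I) with hB
    have hA0 : A ≠ 0 := vg_ne _ _ hz y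
    have hB0 : B ≠ 0 := vg_ne _ _ hw y
    have hQ : 1 - ((θ * ν : ℝ) : ℂ) * ((a : ℂ) + y * Complex.I)
            - ((κ : ℝ) : ℂ) * ((a : ℂ) + y * Complex.I) ^ 2 = A * B := by
      have hspc : (sp : ℂ) ≠ 0 := by exact_mod_cast hsp0.ne'
      rw [hroot, hA, hB]
      push_cast
      field_simp
      ring
    have hAr : |A.arg| < Real.pi / 2 :=
      Complex.abs_arg_lt_pi_div_two_iff.2 (Or.inl (by rw [hA]; simpa using hz))
    have hBr : |B.arg| < Real.pi / 2 :=
      Complex.abs_arg_lt_pi_div_two_iff.2 (Or.inl (by rw [hB]; simpa using hw))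
    rw [abs_lt] at hAr hBr
    rw [hQ, Complex.cpow_def_of_ne_zero (mul_ne_zero hA0 hB0), Complex.log_mul hA0 hB0
      ⟨by linarith, by linarith⟩, ← mul_one_div]
    congr 1
    · congr 1; ring
    · congr 2
      · push_cast; ring
      · push_cast; ring
  have hlog : Real.log (1 - 1 / sp) = -Real.log (sp / (sp - 1)) := by
    rw [← Real.log_inv, inv_div]
    congr 1
    field_simp
  have hlog0 : 0 < Real.log (sp / (sp - 1)) := by
    apply Real.log_pos
    rw [one_lt_div (by linarith)]
    linarith
  rw [sign_pos (show 0 < 1 / sp by positivity), sign_neg (show -(κ * sp) < 0 by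
    rw [neg_lt_zero]; positivity), hlog] at hd
  have ht := (hd.tendsto_slope_zero_right).const_mul
    ((1 / (2 * Real.pi) : ℂ) * ((ν / Real.log (sp / (sp - 1)) : ℝ) : ℂ))
  have hπ : (Real.pi : ℂ) ≠ 0 := by exact_mod_cast Real.pi_ne_zero
  have hνc : (ν : ℂ) ≠ 0 := by exact_mod_cast hν.ne'
  have hlc : (Real.log (sp / (sp - 1)) : ℂ) ≠ 0 := by exact_mod_cast hlog0.ne'
  refine Tendsto.congr' ?_ (ht.trans (le_of_eq ?_))
  · filter_upwards [self_mem_nhdsWithin] with T hT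
    have hT0 : 0 < T := hT
    rw [hFC T hT0, zero_add, hF0, sub_zero, Complex.real_smul]
    have : (T : ℂ) ≠ 0 := by exact_mod_cast hT0.ne'
    push_cast
    field_simp
  · congr 1
    simp only [SignType.coe_one, SignType.coe_neg]
    push_cast
    field_simp
    ring
end

section
/- Let σ > 0, ν > 0, θ ∈ ℝ, b > 0, set Q(s) = 1 − θνs − (σ²ν/2)s² and s₊ = (−θν + √(2νσ² + ν²θ²))/(νσ²). Fix a ∈ (0, s₊). For T > 0 define P(T) = (1/(2π)) ∫_{−∞}^{∞} exp(T b (a+iy)) · Q(a+iy)^{−T/ν} · (a+iy)⁻¹ dy, with Q(a+iy)^{−T/ν} taken in the principal branch. Then lim_{T→0⁺} P(T) = 1. -/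
open MeasureTheory Filter

lemma vg_s_ne (a y : ℝ) (ha : 0 < a) : (a : ℂ) + y * Complex.I ≠ 0 := by
  intro h
  have := congrArg Complex.re h
  simp at this
  exact ha.ne' this

lemma vg_norm_s_sq (a y : ℝ) : ‖(a : ℂ) + y * Complex.I‖ ^ 2 = a ^ 2 + y ^ 2 := by
  rw [← Complex.normSq_eq_norm_sq, Complex.normSq_add_mul_I]

lemma vg_s_lower (a : ℝ) (ha : 0 < a) : ∃ c > 0, ∀ y : ℝ,
    c * (1 + y ^ 2) ^ (1 / 2 : ℝ) ≤ ‖(a : ℂ) + y * Complex.I‖ := by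
  refine ⟨min 1 a, by positivity, fun y => ?_⟩
  rw [← Real.sqrt_eq_rpow]
  apply le_of_sq_le_sq _ (norm_nonneg _)
  rw [vg_norm_s_sq, mul_pow, Real.sq_sqrt (by positivity)]
  have h1 : min 1 a ≤ 1 := min_le_left _ _
  have h2 : min 1 a ≤ a := min_le_right _ _
  have h0 : 0 < min 1 a := by positivity
  have h3 : (min 1 a) ^ 2 ≤ 1 := by nlinarith
  have h4 : (min 1 a) ^ 2 ≤ a ^ 2 := by nlinarith
  nlinarith [sq_nonneg y]

lemma vg_integrable_J (r : ℝ) (hr : r < -(1 / 2)) :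
    Integrable (fun y : ℝ => (1 + y ^ 2) ^ r) := by
  have := integrable_rpow_neg_one_add_norm_sq (E := ℝ) (μ := volume) (r := -2 * r)
    (by simp; linarith)
  convert this using 3 with y
  · simp
  · ring

lemma vg_integrable_inv_sq (a : ℝ) (ha : 0 < a) :
    Integrable (fun y : ℝ => 1 / ((a : ℂ) + y * Complex.I) ^ 2) := by
  obtain ⟨c, hc, h⟩ := vg_s_lower a ha
  refine ((vg_integrable_J (-1) (by norm_num)).const_mul (1 / c ^ 2)).mono' ?_ ?_
  · refine Continuous.aestronglyMeasurable ?_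
    refine continuous_const.div (by fun_prop) fun y => pow_ne_zero _ (vg_s_ne a y ha)
  · refine Eventually.of_forall fun y => ?_
    have hJ : 0 < 1 + y ^ 2 := by positivity
    have := h y
    rw [norm_div, norm_pow, norm_one, Real.rpow_neg_one, ← one_div, div_mul_div_comm, one_mul]
    apply one_div_le_one_div_of_le (by positivity)
    calc c ^ 2 * (1 + y ^ 2) = (c * (1 + y ^ 2) ^ (1 / 2 : ℝ)) ^ 2 := by
          rw [mul_pow, ← Real.sqrt_eq_rpow, Real.sq_sqrt hJ.le]
      _ ≤ _ := by gcongr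

lemma vg_laplace (z : ℂ) (hz : 0 < z.re) :
    IntegrableOn (fun x : ℝ => (x : ℂ) * Complex.exp (-z * x)) (Set.Ioi 0) ∧
    ∫ x in Set.Ioi (0 : ℝ), (x : ℂ) * Complex.exp (-z * x) = 1 / z ^ 2 := by
  have hz0 : z ≠ 0 := by rintro rfl; simp at hz
  have hint : IntegrableOn (fun x : ℝ => (x : ℂ) * Complex.exp (-z * x)) (Set.Ioi 0) := by
    have := integrableOn_rpow_mul_exp_neg_mul_rpow (p := 1) (s := 1) (b := z.re)
      (by norm_num) (by norm_num) hz
    refine Integrable.mono' this ?_ ?_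
    · exact Continuous.aestronglyMeasurable (by fun_prop)
    · refine (ae_restrict_iff' measurableSet_Ioi).2 (Eventually.of_forall fun x hx => ?_)
      have hx : 0 < x := hx
      simp [Complex.norm_exp, abs_of_pos hx]
  refine ⟨hint, ?_⟩
  have hd : ∀ x ∈ Set.Ici (0 : ℝ), HasDerivAt
      (fun x : ℝ => -((x : ℂ) / z + 1 / z ^ 2) * Complex.exp (-z * x))
      ((x : ℂ) * Complex.exp (-z * x)) x := by
    intro x _
    have h1 : HasDerivAt (fun x : ℂ => -(x / z + 1 / z ^ 2) * Complex.exp (-z * x))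
      ((x : ℂ) * Complex.exp (-z * x)) (x : ℂ) := by
      have e1 : HasDerivAt (fun x : ℂ => -(x / z + 1 / z ^ 2)) (-(1 / z)) (x : ℂ) :=
        (((hasDerivAt_id (x : ℂ)).div_const z).add_const _).neg
      have e2 : HasDerivAt (fun x : ℂ => Complex.exp (-z * x))
          (Complex.exp (-z * x) * (-z * 1)) (x : ℂ) :=
        ((hasDerivAt_id (x : ℂ)).const_mul (-z)).cexp
      refine (e1.mul e2).congr_deriv ?_
      field_simp
      ring
    exact h1.comp_ofReal
  have hlim : Tendsto (fun x : ℝ => -((x : ℂ) / z + 1 / z ^ 2) * Complex.exp (-z * x))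
      atTop (nhds 0) := by
    have t1 := tendsto_rpow_mul_exp_neg_mul_atTop_nhds_zero 1 z.re hz
    have t0 := tendsto_rpow_mul_exp_neg_mul_atTop_nhds_zero 0 z.re hz
    have : Tendsto (fun x : ℝ => (1 / ‖z‖) * (x ^ (1 : ℝ) * Real.exp (-z.re * x)) +
      (1 / ‖z‖ ^ 2) * (x ^ (0 : ℝ) * Real.exp (-z.re * x))) atTop (nhds 0) := by
      simpa only [mul_zero, add_zero] using
        (t1.const_mul (1 / ‖z‖)).add (t0.const_mul (1 / ‖z‖ ^ 2))
    refine squeeze_zero_norm' ?_ this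
    filter_upwards [eventually_gt_atTop 0] with x hx
    rw [norm_mul, norm_neg, Complex.norm_exp, Real.rpow_one, Real.rpow_zero]
    have e : (-z * (x : ℂ)).re = -z.re * x := by simp
    rw [e]
    have : ‖(x : ℂ) / z + 1 / z ^ 2‖ ≤ x / ‖z‖ + 1 / ‖z‖ ^ 2 := by
      refine (norm_add_le _ _).trans ?_
      simp [abs_of_pos hx]
    calc _ ≤ (x / ‖z‖ + 1 / ‖z‖ ^ 2) * Real.exp (-z.re * x) := by gcongr
      _ = _ := by ring
  rw [integral_Ioi_of_hasDerivAt_of_tendsto' hd hint hlim]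
  simp

lemma vg_inversion (a c : ℝ) (ha : 0 < a) (hc : 0 < c) :
    ∫ y : ℝ, Complex.exp ((c : ℂ) * ((a : ℂ) + y * Complex.I)) / ((a : ℂ) + y * Complex.I) ^ 2
      = 2 * Real.pi * c := by
  let f : ℝ → ℂ := (Set.Ioi (0 : ℝ)).indicator (fun x : ℝ => (x : ℂ) * Complex.exp (-(a : ℂ) * x))
  have hf : Integrable f := by
    rw [integrable_indicator_iff measurableSet_Ioi]
    exact (vg_laplace a (by simpa using ha)).1
  have hF : ∀ w : ℝ, FourierTransform.fourier f w =
      1 / ((a : ℂ) + ((2 * Real.pi * w : ℝ) : ℂ) * Complex.I) ^ 2 := by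
    intro w
    rw [Real.fourier_real_eq_integral_exp_smul,
      ← (vg_laplace ((a : ℂ) + ((2 * Real.pi * w : ℝ) : ℂ) * Complex.I) (by simpa using ha)).2,
      ← integral_indicator measurableSet_Ioi]
    congr 1 with x
    by_cases hx : x ∈ Set.Ioi (0 : ℝ)
    · simp only [f, Set.indicator_of_mem hx, smul_eq_mul]
      rw [mul_left_comm, ← Complex.exp_add]
      congr 2
      push_cast
      ring
    · simp [f, Set.indicator_of_notMem hx]
  have hFi : Integrable (FourierTransform.fourier f) := by
    rw [show FourierTransform.fourier f = _ from funext hF]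
    exact (vg_integrable_inv_sq a ha).comp_mul_left' (R := 2 * Real.pi) (by positivity)
  have hca : ContinuousAt f c := by
    have : (fun x : ℝ => (x : ℂ) * Complex.exp (-(a : ℂ) * x)) =ᶠ[nhds c] f := by
      filter_upwards [Ioi_mem_nhds hc] with x hx
      simp only [f, Set.indicator_of_mem hx]
    refine ContinuousAt.congr ?_ this
    exact Continuous.continuousAt (by fun_prop)
  have key := hf.fourierInv_fourier_eq hFi hca
  rw [Real.fourierInv_eq'] at key
  simp only [hF, smul_eq_mul] at key
  have hsub := Measure.integral_comp_mul_left
    (fun y : ℝ => Complex.exp (((c * y : ℝ) : ℂ) * Complex.I) * (1 / ((a : ℂ) + y * Complex.I) ^ 2))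
    (2 * Real.pi)
  have hc' : f c = c * Complex.exp (-(a : ℂ) * c) := by
    simp only [f, Set.indicator_of_mem (show c ∈ Set.Ioi (0 : ℝ) from hc)]
  rw [hc'] at key
  have e1 : ∫ y : ℝ, Complex.exp ((c : ℂ) * ((a : ℂ) + y * Complex.I)) /
      ((a : ℂ) + y * Complex.I) ^ 2 = Complex.exp (a * c) * ∫ y : ℝ,
      Complex.exp (((c * y : ℝ) : ℂ) * Complex.I) * (1 / ((a : ℂ) + y * Complex.I) ^ 2) := by
    rw [← integral_const_mul]
    congr 1 with y
    rw [← mul_assoc, ← Complex.exp_add, mul_one_div]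
    congr 2
    push_cast
    ring
  have e2 : ∫ x : ℝ, (fun y : ℝ => Complex.exp (((c * y : ℝ) : ℂ) * Complex.I) *
      (1 / ((a : ℂ) + y * Complex.I) ^ 2)) (2 * Real.pi * x) = c * Complex.exp (-(a : ℂ) * c) := by
    rw [← key]
    congr 1 with x
    simp only [RCLike.inner_apply, conj_trivial]
    congr 3
    push_cast
    ring
  rw [e2] at hsub
  rw [e1]
  set X := ∫ y : ℝ, Complex.exp (((c * y : ℝ) : ℂ) * Complex.I) *
      (1 / ((a : ℂ) + y * Complex.I) ^ 2)
  have hpi : (2 * Real.pi : ℂ) ≠ 0 := by simp [Real.pi_ne_zero]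
  have hX : X = 2 * Real.pi * (c * Complex.exp (-(a : ℂ) * c)) := by
    rw [hsub, abs_of_pos (by positivity), Complex.real_smul]
    push_cast
    field_simp
  rw [hX]
  have : Complex.exp ((a : ℂ) * c) * Complex.exp (-(a : ℂ) * c) = 1 := by
    rw [← Complex.exp_add]; simp
  linear_combination (2 * Real.pi * c : ℂ) * this

/-- the vertical line -/
noncomputable def vgS (a y : ℝ) : ℂ := (a : ℂ) + y * Complex.I

/-- the quadratic on the vertical line -/
noncomputable def vgQ (m k a y : ℝ) : ℂ := 1 - (m : ℂ) * vgS a y - (k : ℂ) * vgS a y ^ 2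

/-- derivative of the quadratic -/
noncomputable def vgQd (m k a y : ℝ) : ℂ := -(m : ℂ) - 2 * (k : ℂ) * vgS a y

/-- the power `Q^(-T/ν)` written with exp and log -/
noncomputable def vgF (m k ν a T y : ℝ) : ℂ := Complex.exp (-((T / ν : ℝ) : ℂ) * Complex.log (vgQ m k a y))

/-- the remainder integrand -/
noncomputable def vgD (m k ν a T y : ℝ) : ℂ :=
  (vgF m k ν a T y - 1) / T / vgS a y ^ 2
    + 1 / (ν : ℂ) * (vgF m k ν a T y * vgQd m k a y / (vgQ m k a y * vgS a y))

/-- the limit of the remainder integrand -/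
noncomputable def vgD0 (m k ν a y : ℝ) : ℂ :=
  -(Complex.log (vgQ m k a y)) / ν / vgS a y ^ 2
    + 1 / (ν : ℂ) * (vgQd m k a y / (vgQ m k a y * vgS a y))

lemma vgQ_re (m k a y : ℝ) : (vgQ m k a y).re = 1 - m * a - k * a ^ 2 + k * y ^ 2 := by
  simp [vgQ, vgS, pow_two]
  ring

lemma vgQ_lower (m k a : ℝ) (hk : 0 < k) (hq : 0 < 1 - m * a - k * a ^ 2) :
    ∃ κ > 0, ∀ y, κ * (1 + y ^ 2) ≤ (vgQ m k a y).re := by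
  refine ⟨min (1 - m * a - k * a ^ 2) k, lt_min hq hk, fun y => ?_⟩
  rw [vgQ_re]
  nlinarith [min_le_left (1 - m * a - k * a ^ 2) k, min_le_right (1 - m * a - k * a ^ 2) k,
    mul_le_mul_of_nonneg_right (min_le_right (1 - m * a - k * a ^ 2) k) (sq_nonneg y)]

lemma vgQ_upper (m k a : ℝ) (hk : 0 < k) :
    ∃ K > 0, ∀ y, ‖vgQ m k a y‖ ≤ K * (1 + y ^ 2) := by
  refine ⟨1 + |m| * (2 + a ^ 2) + k * (1 + a ^ 2), by positivity, fun y => ?_⟩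
  have h1 : ‖vgQ m k a y‖ ≤ 1 + |m| * ‖vgS a y‖ + k * ‖vgS a y‖ ^ 2 := by
    unfold vgQ
    refine (norm_sub_le _ _).trans (add_le_add ((norm_sub_le _ _).trans ?_) ?_)
    · simp
    · simp [abs_of_pos hk]
  have h2 : ‖vgS a y‖ ^ 2 = a ^ 2 + y ^ 2 := vg_norm_s_sq a y
  have h3 : ‖vgS a y‖ ≤ 1 + ‖vgS a y‖ ^ 2 := by nlinarith [sq_nonneg (‖vgS a y‖ - 1)]
  have h4 : |m| * ‖vgS a y‖ ≤ |m| * (1 + (a ^ 2 + y ^ 2)) := by rw [← h2]; gcongr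
  rw [h2] at h1
  have h5 : 0 ≤ |m| * (1 + y ^ 2 * (1 + a ^ 2)) := by positivity
  have h6 : 0 ≤ k * (1 + a ^ 2 * y ^ 2) := by positivity
  nlinarith [sq_nonneg y]

lemma vgS_ne (a y : ℝ) (ha : 0 < a) : vgS a y ≠ 0 := vg_s_ne a y ha

lemma vgQ_slit (m k a y : ℝ) (hk : 0 < k) (hq : 0 < 1 - m * a - k * a ^ 2) :
    vgQ m k a y ∈ Complex.slitPlane := by
  left
  rw [vgQ_re]
  positivity

lemma vgQ_ne (m k a y : ℝ) (hk : 0 < k) (hq : 0 < 1 - m * a - k * a ^ 2) :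
    vgQ m k a y ≠ 0 := Complex.slitPlane_ne_zero (vgQ_slit m k a y hk hq)

lemma vgS_deriv (a y : ℝ) : HasDerivAt (fun y => vgS a y) Complex.I y := by
  unfold vgS
  have h : HasDerivAt (fun y : ℝ => (y : ℂ)) 1 y := Complex.ofRealCLM.hasDerivAt
  exact ((h.mul_const Complex.I).const_add (a : ℂ)).congr_deriv (by ring)

lemma vgQ_deriv (m k a y : ℝ) :
    HasDerivAt (fun y => vgQ m k a y) (vgQd m k a y * Complex.I) y := by
  have h := vgS_deriv a y
  unfold vgQ
  refine (((h.const_mul (m : ℂ)).const_sub 1).sub ((h.pow 2).const_mul (k : ℂ))).congr_deriv ?_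
  simp [vgQd]
  ring

lemma vgL_deriv (m k a y : ℝ) (hk : 0 < k) (hq : 0 < 1 - m * a - k * a ^ 2) :
    HasDerivAt (fun y => Complex.log (vgQ m k a y))
      (vgQd m k a y * Complex.I / vgQ m k a y) y :=
  (vgQ_deriv m k a y).clog_real (vgQ_slit m k a y hk hq)

lemma vgF_deriv (m k ν a T y : ℝ) (hk : 0 < k) (hq : 0 < 1 - m * a - k * a ^ 2) :
    HasDerivAt (fun y => vgF m k ν a T y)
      (vgF m k ν a T y * (-((T / ν : ℝ) : ℂ) * (vgQd m k a y * Complex.I / vgQ m k a y))) y := by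
  unfold vgF
  exact ((vgL_deriv m k a y hk hq).const_mul _).cexp

lemma vgS_cont (a : ℝ) : Continuous (fun y => vgS a y) := by unfold vgS; fun_prop
lemma vgQd_cont (m k a : ℝ) : Continuous (fun y => vgQd m k a y) := by
  unfold vgQd vgS; fun_prop
lemma vgQ_cont (m k a : ℝ) : Continuous (fun y => vgQ m k a y) := by
  unfold vgQ vgS; fun_prop
lemma vgF_cont (m k ν a T : ℝ) (hk : 0 < k) (hq : 0 < 1 - m * a - k * a ^ 2) :
    Continuous (fun y => vgF m k ν a T y) :=
  continuous_iff_continuousAt.2 fun y => (vgF_deriv m k ν a T y hk hq).continuousAt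
lemma vgL_cont (m k a : ℝ) (hk : 0 < k) (hq : 0 < 1 - m * a - k * a ^ 2) :
    Continuous (fun y => Complex.log (vgQ m k a y)) :=
  continuous_iff_continuousAt.2 fun y => (vgL_deriv m k a y hk hq).continuousAt

lemma vgD_cont (m k ν a T : ℝ) (ha : 0 < a) (hk : 0 < k) (hq : 0 < 1 - m * a - k * a ^ 2) :
    Continuous (fun y => vgD m k ν a T y) := by
  unfold vgD
  refine Continuous.add ?_ (continuous_const.mul ?_)
  · exact (((vgF_cont m k ν a T hk hq).sub continuous_const).div_const _).div
      ((vgS_cont a).pow 2) fun y => pow_ne_zero _ (vgS_ne a y ha)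
  · exact ((vgF_cont m k ν a T hk hq).mul (vgQd_cont m k a)).div
      ((vgQ_cont m k a).mul (vgS_cont a))
      fun y => mul_ne_zero (vgQ_ne m k a y hk hq) (vgS_ne a y ha)

lemma vgD0_cont (m k ν a : ℝ) (ha : 0 < a) (hk : 0 < k) (hq : 0 < 1 - m * a - k * a ^ 2) :
    Continuous (fun y => vgD0 m k ν a y) := by
  unfold vgD0
  refine Continuous.add ?_ (continuous_const.mul ?_)
  · exact (((vgL_cont m k a hk hq).neg).div_const _).div
      ((vgS_cont a).pow 2) fun y => pow_ne_zero _ (vgS_ne a y ha)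
  · exact (vgQd_cont m k a).div
      ((vgQ_cont m k a).mul (vgS_cont a))
      fun y => mul_ne_zero (vgQ_ne m k a y hk hq) (vgS_ne a y ha)

lemma vgL_bound (m k a : ℝ) (hk : 0 < k) (hq : 0 < 1 - m * a - k * a ^ 2) :
    ∃ C > 0, ∀ y, ‖Complex.log (vgQ m k a y)‖ ≤ C * (1 + y ^ 2) ^ (1 / 4 : ℝ) := by
  obtain ⟨κ, hκ, hlo⟩ := vgQ_lower m k a hk hq
  obtain ⟨K, hK, hup⟩ := vgQ_upper m k a hk
  refine ⟨|Real.log K| + |Real.log κ| + 4 + Real.pi, by positivity, fun y => ?_⟩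
  have hJ : (1 : ℝ) ≤ 1 + y ^ 2 := by nlinarith [sq_nonneg y]
  have hJ0 : (0 : ℝ) < 1 + y ^ 2 := by linarith
  have hQ0 : κ * (1 + y ^ 2) ≤ ‖vgQ m k a y‖ := (hlo y).trans (Complex.re_le_norm _)
  have hQp : 0 < ‖vgQ m k a y‖ := lt_of_lt_of_le (by positivity) hQ0
  have hlJ : Real.log (1 + y ^ 2) ≤ 4 * (1 + y ^ 2) ^ (1 / 4 : ℝ) := by
    have := Real.log_le_rpow_div hJ0.le (show (0 : ℝ) < 1 / 4 by norm_num)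
    linarith
  have hlJ0 : 0 ≤ Real.log (1 + y ^ 2) := Real.log_nonneg hJ
  have h1 : Real.log ‖vgQ m k a y‖ ≤ Real.log K + Real.log (1 + y ^ 2) := by
    rw [← Real.log_mul hK.ne' hJ0.ne']
    exact Real.log_le_log hQp (hup y)
  have h2 : Real.log κ + Real.log (1 + y ^ 2) ≤ Real.log ‖vgQ m k a y‖ := by
    rw [← Real.log_mul hκ.ne' hJ0.ne']
    exact Real.log_le_log (by positivity) hQ0
  have h3 : |Real.log ‖vgQ m k a y‖| ≤ |Real.log K| + |Real.log κ| + 4 * (1 + y ^ 2) ^ (1 / 4 : ℝ) := by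
    rw [abs_le]
    constructor
    · have : 0 ≤ (1 + y ^ 2) ^ (1 / 4 : ℝ) := by positivity
      linarith [neg_abs_le (Real.log κ), abs_nonneg (Real.log K)]
    · linarith [le_abs_self (Real.log K), abs_nonneg (Real.log κ)]
  have h4 : ‖Complex.log (vgQ m k a y)‖ ≤ |Real.log ‖vgQ m k a y‖| + Real.pi := by
    refine (Complex.norm_le_abs_re_add_abs_im _).trans ?_
    rw [Complex.log_re, Complex.log_im]
    gcongr
    exact Complex.abs_arg_le_pi _
  have h5 : 1 ≤ (1 + y ^ 2) ^ (1 / 4 : ℝ) := Real.one_le_rpow hJ (by norm_num)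
  have h6 : 0 ≤ |Real.log K| + |Real.log κ| + Real.pi := by positivity
  nlinarith

lemma vg_exp_sub_one (w : ℂ) (B : ℝ) (hB : 0 ≤ B) (hw : w.re ≤ B) :
    ‖Complex.exp w - 1‖ ≤ Real.exp B * ‖w‖ := by
  have := Convex.norm_image_sub_le_of_norm_hasDerivWithin_le (f := Complex.exp)
    (f' := Complex.exp) (s := {z : ℂ | z.re ≤ B}) (C := Real.exp B) (x := 0) (y := w)
    (fun x _ => (Complex.hasDerivAt_exp x).hasDerivWithinAt)
    (fun x hx => by rw [Complex.norm_exp]; exact Real.exp_le_exp.2 hx)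
    (convex_halfSpace_re_le B) (by simpa using hB) hw
  simpa using this

/-- bounds for `F` valid for `0 < T ≤ 1` -/
lemma vgF_bound (m k ν a : ℝ) (hν : 0 < ν) (hk : 0 < k) (hq : 0 < 1 - m * a - k * a ^ 2) :
    ∃ M > 0, ∀ T y, 0 < T → T ≤ 1 → ‖vgF m k ν a T y‖ ≤ M ∧
      ‖(vgF m k ν a T y - 1) / T‖ ≤ M * (1 + y ^ 2) ^ (1 / 4 : ℝ) := by
  obtain ⟨κ, hκ, hlo⟩ := vgQ_lower m k a hk hq
  obtain ⟨C, hC, hL⟩ := vgL_bound m k a hk hq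
  refine ⟨Real.exp (|Real.log κ| / ν) * (1 + C / ν), by positivity, fun T y hT hT1 => ?_⟩
  have hJ : (1 : ℝ) ≤ 1 + y ^ 2 := by nlinarith [sq_nonneg y]
  have hQ0 : κ ≤ ‖vgQ m k a y‖ := by
    refine le_trans ?_ ((hlo y).trans (Complex.re_le_norm _))
    nlinarith
  have hre : (-((T / ν : ℝ) : ℂ) * Complex.log (vgQ m k a y)).re ≤ |Real.log κ| / ν := by
    rw [← Complex.ofReal_neg, Complex.re_ofReal_mul, Complex.log_re]
    have h1 : -|Real.log κ| ≤ Real.log ‖vgQ m k a y‖ :=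
      (neg_abs_le _).trans (Real.log_le_log hκ hQ0)
    calc -(T / ν) * Real.log ‖vgQ m k a y‖ ≤ (T / ν) * |Real.log κ| := by
          have : 0 < T / ν := by positivity
          nlinarith
      _ ≤ (1 / ν) * |Real.log κ| := by gcongr
      _ = _ := by ring
  have hM : Real.exp (|Real.log κ| / ν) ≤ Real.exp (|Real.log κ| / ν) * (1 + C / ν) := by
    have : 0 < C / ν := by positivity
    nlinarith [Real.exp_pos (|Real.log κ| / ν)]
  constructor
  · refine le_trans ?_ hM
    rw [vgF, Complex.norm_exp]
    exact Real.exp_le_exp.2 hre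
  · have h := vg_exp_sub_one _ _ (by positivity) hre
    rw [norm_div, Complex.norm_real, Real.norm_of_nonneg hT.le, div_le_iff₀ hT]
    refine h.trans ?_
    rw [norm_mul, norm_neg, Complex.norm_real, Real.norm_of_nonneg (by positivity)]
    calc Real.exp (|Real.log κ| / ν) * (T / ν * ‖Complex.log (vgQ m k a y)‖)
        ≤ Real.exp (|Real.log κ| / ν) * (T / ν * (C * (1 + y ^ 2) ^ (1 / 4 : ℝ))) := by
          gcongr; exact hL y
      _ = Real.exp (|Real.log κ| / ν) * (C / ν) * (1 + y ^ 2) ^ (1 / 4 : ℝ) * T := by ring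
      _ ≤ _ := by gcongr; linarith

lemma vgQd_bound (m k a : ℝ) (ha : 0 < a) (hk : 0 < k) (hq : 0 < 1 - m * a - k * a ^ 2) :
    ∃ C > 0, ∀ y, ‖vgQd m k a y / (vgQ m k a y * vgS a y)‖ ≤ C * (1 + y ^ 2) ^ (-(3 / 4) : ℝ) := by
  obtain ⟨κ, hκ, hlo⟩ := vgQ_lower m k a hk hq
  refine ⟨(|m| / a + 2 * k) / κ, by positivity, fun y => ?_⟩
  have hJ : (1 : ℝ) ≤ 1 + y ^ 2 := by nlinarith [sq_nonneg y]
  have hJ0 : (0 : ℝ) < 1 + y ^ 2 := by linarith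
  have hQ0 : κ * (1 + y ^ 2) ≤ ‖vgQ m k a y‖ := (hlo y).trans (Complex.re_le_norm _)
  have hs : 0 < ‖vgS a y‖ := norm_pos_iff.2 (vgS_ne a y ha)
  have hsa : a ≤ ‖vgS a y‖ := by
    have := Complex.re_le_norm (vgS a y)
    simpa [vgS] using this
  have h1 : ‖vgQd m k a y‖ ≤ (|m| / a + 2 * k) * ‖vgS a y‖ := by
    have : ‖vgQd m k a y‖ ≤ |m| + 2 * k * ‖vgS a y‖ := by
      unfold vgQd
      refine (norm_sub_le _ _).trans ?_
      simp [abs_of_pos hk]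
    have h2 : |m| ≤ |m| / a * ‖vgS a y‖ := by
      rw [div_mul_eq_mul_div, le_div_iff₀ ha]
      gcongr
    linarith
  have hQp : 0 < ‖vgQ m k a y‖ := lt_of_lt_of_le (by positivity) hQ0
  rw [norm_div, norm_mul]
  calc ‖vgQd m k a y‖ / (‖vgQ m k a y‖ * ‖vgS a y‖)
      ≤ (|m| / a + 2 * k) * ‖vgS a y‖ / (κ * (1 + y ^ 2) * ‖vgS a y‖) := by gcongr
    _ = (|m| / a + 2 * k) / κ * (1 + y ^ 2) ^ (-1 : ℝ) := by
        rw [Real.rpow_neg_one]; field_simp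
    _ ≤ _ := by
        gcongr
        norm_num

lemma vg_over_sq_bound (a : ℝ) (ha : 0 < a) : ∃ C > 0, ∀ (y M : ℝ) (z : ℂ), 
    ‖z‖ ≤ M * (1 + y ^ 2) ^ (1 / 4 : ℝ) →
    ‖z / vgS a y ^ 2‖ ≤ C * M * (1 + y ^ 2) ^ (-(3 / 4) : ℝ) := by
  obtain ⟨c, hc, h⟩ := vg_s_lower a ha
  refine ⟨1 / c ^ 2, by positivity, fun y M z hz => ?_⟩
  have hJ0 : (0 : ℝ) < 1 + y ^ 2 := by positivity
  have h1 : c ^ 2 * (1 + y ^ 2) ≤ ‖vgS a y‖ ^ 2 := by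
    calc c ^ 2 * (1 + y ^ 2) = (c * (1 + y ^ 2) ^ (1 / 2 : ℝ)) ^ 2 := by
          rw [mul_pow, ← Real.sqrt_eq_rpow, Real.sq_sqrt hJ0.le]
      _ ≤ _ := by gcongr; exact h y
  rw [norm_div, norm_pow]
  calc ‖z‖ / ‖vgS a y‖ ^ 2 ≤ M * (1 + y ^ 2) ^ (1 / 4 : ℝ) / (c ^ 2 * (1 + y ^ 2)) := by
        apply div_le_div₀ ((norm_nonneg _).trans hz) hz (by positivity) h1
    _ = 1 / c ^ 2 * M * ((1 + y ^ 2) ^ (1 / 4 : ℝ) * (1 + y ^ 2) ^ (-1 : ℝ)) := by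
        rw [Real.rpow_neg_one]; field_simp
    _ = _ := by rw [← Real.rpow_add hJ0]; norm_num

lemma vgD_bound (m k ν a : ℝ) (ha : 0 < a) (hν : 0 < ν) (hk : 0 < k)
    (hq : 0 < 1 - m * a - k * a ^ 2) :
    ∃ C > 0, ∀ T y, 0 < T → T ≤ 1 → ‖vgD m k ν a T y‖ ≤ C * (1 + y ^ 2) ^ (-(3 / 4) : ℝ) := by
  obtain ⟨M, hM, hF⟩ := vgF_bound m k ν a hν hk hq
  obtain ⟨C1, hC1, h1⟩ := vgQd_bound m k a ha hk hq
  obtain ⟨C2, hC2, h2⟩ := vg_over_sq_bound a ha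
  refine ⟨C2 * M + 1 / ν * (M * C1), by positivity, fun T y hT hT1 => ?_⟩
  obtain ⟨hF1, hF2⟩ := hF T y hT hT1
  unfold vgD
  refine (norm_add_le _ _).trans ?_
  rw [add_mul]
  refine add_le_add (h2 y M _ hF2) ?_
  rw [norm_mul, mul_div_assoc, norm_mul, mul_assoc, mul_assoc]
  have : ‖1 / (ν : ℂ)‖ = 1 / ν := by simp [abs_of_pos hν]
  rw [this]
  gcongr
  exact h1 y

lemma vgD0_bound (m k ν a : ℝ) (ha : 0 < a) (hν : 0 < ν) (hk : 0 < k)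
    (hq : 0 < 1 - m * a - k * a ^ 2) :
    ∃ C > 0, ∀ y, ‖vgD0 m k ν a y‖ ≤ C * (1 + y ^ 2) ^ (-(3 / 4) : ℝ) := by
  obtain ⟨M, hM, hF⟩ := vgL_bound m k a hk hq
  obtain ⟨C1, hC1, h1⟩ := vgQd_bound m k a ha hk hq
  obtain ⟨C2, hC2, h2⟩ := vg_over_sq_bound a ha
  refine ⟨C2 * (M / ν) + 1 / ν * C1, by positivity, fun y => ?_⟩
  unfold vgD0
  refine (norm_add_le _ _).trans ?_
  rw [add_mul]
  refine add_le_add (h2 y (M / ν) _ ?_) ?_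
  · rw [norm_div, norm_neg, Complex.norm_real, Real.norm_of_nonneg hν.le, div_mul_eq_mul_div]
    gcongr
    exact hF y
  rw [norm_mul, mul_assoc]
  have : ‖1 / (ν : ℂ)‖ = 1 / ν := by simp [abs_of_pos hν]
  rw [this]
  gcongr
  exact h1 y

lemma vgD0_integral (m k ν a : ℝ) (ha : 0 < a) (hν : 0 < ν) (hk : 0 < k)
    (hq : 0 < 1 - m * a - k * a ^ 2) : ∫ y, vgD0 m k ν a y = 0 := by
  obtain ⟨C, hC, hb⟩ := vgD0_bound m k ν a ha hν hk hq
  obtain ⟨CL, hCL, hL⟩ := vgL_bound m k a hk hq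
  obtain ⟨c, hc, hs⟩ := vg_s_lower a ha
  have hint : Integrable (fun y => vgD0 m k ν a y) :=
    ((vg_integrable_J (-(3 / 4)) (by norm_num)).const_mul C).mono'
      (vgD0_cont m k ν a ha hk hq).aestronglyMeasurable (Eventually.of_forall hb)
  let G : ℝ → ℂ := fun y => 1 / (ν * Complex.I) * (Complex.log (vgQ m k a y) / vgS a y)
  have hν' : (ν : ℂ) ≠ 0 := by exact_mod_cast hν.ne'
  have hG : ∀ y, HasDerivAt G (vgD0 m k ν a y) y := by
    intro y
    have hs0 := vgS_ne a y ha
    have hQ0 := vgQ_ne m k a y hk hq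
    refine (((vgL_deriv m k a y hk hq).div (vgS_deriv a y) hs0).const_mul _).congr_deriv ?_
    unfold vgD0
    have hI := Complex.I_ne_zero
    field_simp
    ring
  have hlim : ∀ l : Filter ℝ, Tendsto (fun y : ℝ => 1 + y ^ 2) l atTop → Tendsto G l (nhds 0) := by
    intro l hl
    have h0 : Tendsto (fun y : ℝ => (CL / (c * ν)) * (1 + y ^ 2) ^ (-(1 / 4) : ℝ)) l (nhds 0) := by
      simpa using ((tendsto_rpow_neg_atTop (show (0 : ℝ) < 1 / 4 by norm_num)).comp hl).const_mul
        (CL / (c * ν))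
    refine squeeze_zero_norm (fun y => ?_) h0
    have hJ0 : (0 : ℝ) < 1 + y ^ 2 := by positivity
    have e : ‖G y‖ = 1 / ν * (‖Complex.log (vgQ m k a y)‖ / ‖vgS a y‖) := by
      simp [G, abs_of_pos hν]
    rw [e]
    calc 1 / ν * (‖Complex.log (vgQ m k a y)‖ / ‖vgS a y‖)
        ≤ 1 / ν * ((CL * (1 + y ^ 2) ^ (1 / 4 : ℝ)) / (c * (1 + y ^ 2) ^ (1 / 2 : ℝ))) := by
          gcongr
          · exact hL y
          · exact hs y
      _ = (CL / (c * ν)) * ((1 + y ^ 2) ^ (1 / 4 : ℝ) / (1 + y ^ 2) ^ (1 / 2 : ℝ)) := by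
          field_simp
      _ = _ := by rw [← Real.rpow_sub hJ0]; norm_num
  have ht : Tendsto (fun y : ℝ => 1 + y ^ 2) atTop atTop :=
    tendsto_atTop_add_const_left _ _ (tendsto_pow_atTop two_ne_zero)
  have hbt : Tendsto (fun y : ℝ => 1 + y ^ 2) atBot atTop := by
    simpa [Function.comp_def] using ht.comp tendsto_neg_atBot_atTop
  rw [integral_of_hasDerivAt_of_tendsto hG hint (hlim _ hbt) (hlim _ ht), sub_zero]

lemma vgD_tendsto (m k ν a y : ℝ) :
    Tendsto (fun T => vgD m k ν a T y) (nhdsWithin 0 (Set.Ioi 0)) (nhds (vgD0 m k ν a y)) := by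
  have hd : HasDerivAt (fun T : ℝ => vgF m k ν a T y) (-(Complex.log (vgQ m k a y)) / ν) 0 := by
    have h : HasDerivAt (fun T : ℝ => (T : ℂ)) 1 0 := Complex.ofRealCLM.hasDerivAt
    have h2 := (h.mul_const (-(Complex.log (vgQ m k a y)) / ν)).cexp
    have e : (fun T : ℝ => vgF m k ν a T y) =
        fun T : ℝ => Complex.exp (T * (-(Complex.log (vgQ m k a y)) / ν)) := by
      funext T
      unfold vgF
      congr 1
      push_cast
      ring
    rw [e]
    simpa using h2
  have h0 : vgF m k ν a 0 y = 1 := by simp [vgF]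
  have hF : Tendsto (fun T => vgF m k ν a T y) (nhdsWithin 0 (Set.Ioi 0)) (nhds 1) := by
    have := hd.continuousAt.tendsto
    rw [h0] at this
    exact this.mono_left nhdsWithin_le_nhds
  have hs : Tendsto (fun T : ℝ => (vgF m k ν a T y - 1) / T) (nhdsWithin 0 (Set.Ioi 0))
      (nhds (-(Complex.log (vgQ m k a y)) / ν)) := by
    have := hd.tendsto_slope.mono_left
      (nhdsWithin_mono (0 : ℝ) (show Set.Ioi (0 : ℝ) ⊆ {0}ᶜ from fun x hx => ne_of_gt hx))
    refine this.congr fun T => ?_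
    rw [slope_def_module, h0, sub_zero, Complex.real_smul]
    push_cast
    ring
  unfold vgD vgD0
  refine (hs.div_const _).add (Tendsto.const_mul _ ?_)
  simpa using (hF.mul_const (vgQd m k a y)).div_const (vgQ m k a y * vgS a y)

lemma vg_norm_exp (a T b y : ℝ) :
    ‖Complex.exp ((T : ℂ) * b * vgS a y)‖ = Real.exp (T * b * a) := by
  rw [Complex.norm_exp, ← Complex.ofReal_mul, Complex.re_ofReal_mul]
  simp [vgS]

lemma vg_exp_cont (a T b : ℝ) :
    Continuous (fun y => Complex.exp ((T : ℂ) * b * vgS a y)) := by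
  unfold vgS; fun_prop

lemma vg_remainder_tendsto (m k ν a b : ℝ) (ha : 0 < a) (hν : 0 < ν) (hk : 0 < k) (hb : 0 < b)
    (hq : 0 < 1 - m * a - k * a ^ 2) :
    Tendsto (fun T : ℝ => ∫ y, Complex.exp ((T : ℂ) * b * vgS a y) * vgD m k ν a T y)
      (nhdsWithin 0 (Set.Ioi 0)) (nhds 0) := by
  obtain ⟨C, hC, hbd⟩ := vgD_bound m k ν a ha hν hk hq
  rw [← vgD0_integral m k ν a ha hν hk hq]
  refine tendsto_integral_filter_of_dominated_convergence
    (fun y => Real.exp (b * a) * (C * (1 + y ^ 2) ^ (-(3 / 4) : ℝ))) ?_ ?_ ?_ ?_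
  · exact Eventually.of_forall fun T =>
      ((vg_exp_cont a T b).mul (vgD_cont m k ν a T ha hk hq)).aestronglyMeasurable
  · filter_upwards [Ioc_mem_nhdsGT (show (0 : ℝ) < 1 by norm_num)] with T hT
    refine Eventually.of_forall fun y => ?_
    rw [norm_mul, vg_norm_exp]
    gcongr
    · have : 0 < b * a := by positivity
      nlinarith [hT.2]
    · exact hbd T y hT.1 hT.2
  · exact ((vg_integrable_J (-(3 / 4)) (by norm_num)).const_mul C).const_mul _
  · refine Eventually.of_forall fun y => ?_
    have h1 : Tendsto (fun T : ℝ => Complex.exp ((T : ℂ) * b * vgS a y))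
        (nhdsWithin 0 (Set.Ioi 0)) (nhds 1) := by
      have : Continuous (fun T : ℝ => Complex.exp ((T : ℂ) * b * vgS a y)) := by fun_prop
      have := (this.tendsto 0).mono_left (nhdsWithin_le_nhds (s := Set.Ioi (0 : ℝ)))
      simpa using this
    simpa using h1.mul (vgD_tendsto m k ν a y)

lemma vg_integrable_main (m k ν a b T : ℝ) (ha : 0 < a) (hν : 0 < ν) (hk : 0 < k)
    (hq : 0 < 1 - m * a - k * a ^ 2) (hT : 0 < T) :
    Integrable (fun y => Complex.exp ((T : ℂ) * b * vgS a y) * vgF m k ν a T y / vgS a y) := by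
  obtain ⟨κ, hκ, hlo⟩ := vgQ_lower m k a hk hq
  obtain ⟨c, hc, hs⟩ := vg_s_lower a ha
  have hTν : 0 < T / ν := by positivity
  refine ((vg_integrable_J (-(T / ν) - 1 / 2) (by linarith)).const_mul
    (Real.exp (T * b * a) * (κ ^ (-(T / ν)) / c))).mono' ?_ (Eventually.of_forall fun y => ?_)
  · exact (((vg_exp_cont a T b).mul (vgF_cont m k ν a T hk hq)).div (vgS_cont a)
      fun y => vgS_ne a y ha).aestronglyMeasurable
  · have hJ0 : (0 : ℝ) < 1 + y ^ 2 := by positivity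
    have hQ0 : κ * (1 + y ^ 2) ≤ ‖vgQ m k a y‖ := (hlo y).trans (Complex.re_le_norm _)
    have hQp : 0 < ‖vgQ m k a y‖ := lt_of_lt_of_le (by positivity) hQ0
    have hF : ‖vgF m k ν a T y‖ ≤ κ ^ (-(T / ν)) * (1 + y ^ 2) ^ (-(T / ν)) := by
      rw [← Real.mul_rpow hκ.le hJ0.le, vgF, Complex.norm_exp, ← Complex.ofReal_neg,
        Complex.re_ofReal_mul, Complex.log_re]
      refine le_trans (le_of_eq ?_)
        (Real.rpow_le_rpow_of_nonpos (z := -(T / ν)) (by positivity) hQ0 (by linarith))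
      rw [Real.rpow_def_of_pos hQp, mul_comm]
    rw [norm_div, norm_mul, vg_norm_exp]
    calc Real.exp (T * b * a) * ‖vgF m k ν a T y‖ / ‖vgS a y‖
        ≤ Real.exp (T * b * a) * (κ ^ (-(T / ν)) * (1 + y ^ 2) ^ (-(T / ν))) /
          (c * (1 + y ^ 2) ^ (1 / 2 : ℝ)) := by
          gcongr
          exact hs y
      _ = Real.exp (T * b * a) * (κ ^ (-(T / ν)) / c) *
          ((1 + y ^ 2) ^ (-(T / ν)) / (1 + y ^ 2) ^ (1 / 2 : ℝ)) := by field_simp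
      _ = _ := by rw [← Real.rpow_sub hJ0]

lemma vg_identity (m k ν a b T : ℝ) (ha : 0 < a) (hν : 0 < ν) (hk : 0 < k) (hb : 0 < b)
    (hq : 0 < 1 - m * a - k * a ^ 2) (hT : 0 < T) (hT1 : T ≤ 1) :
    (b : ℂ) * ∫ y, Complex.exp ((T : ℂ) * b * vgS a y) * vgF m k ν a T y / vgS a y
      = 2 * Real.pi * b + ∫ y, Complex.exp ((T : ℂ) * b * vgS a y) * vgD m k ν a T y := by
  have i1 := vg_integrable_main m k ν a b T ha hν hk hq hT
  have i2 : Integrable (fun y => Complex.exp ((T : ℂ) * b * vgS a y) * vgD m k ν a T y) := by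
    obtain ⟨C, hC, hbd⟩ := vgD_bound m k ν a ha hν hk hq
    refine (((vg_integrable_J (-(3 / 4)) (by norm_num)).const_mul C).const_mul
      (Real.exp (T * b * a))).mono' ((vg_exp_cont a T b).mul
        (vgD_cont m k ν a T ha hk hq)).aestronglyMeasurable (Eventually.of_forall fun y => ?_)
    rw [norm_mul, vg_norm_exp]
    gcongr
    exact hbd T y hT hT1
  have i3 : Integrable (fun y => Complex.exp ((T : ℂ) * b * vgS a y) / vgS a y ^ 2) := by
    refine ((vg_integrable_inv_sq a ha).norm.const_mul (Real.exp (T * b * a))).mono'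
      (((vg_exp_cont a T b).div ((vgS_cont a).pow 2)
        fun y => pow_ne_zero _ (vgS_ne a y ha)).aestronglyMeasurable)
      (Eventually.of_forall fun y => ?_)
    rw [norm_div, vg_norm_exp, norm_div, norm_one, mul_one_div]
    rfl
  have hT' : (T : ℂ) ≠ 0 := by exact_mod_cast hT.ne'
  have hν' : (ν : ℂ) ≠ 0 := by exact_mod_cast hν.ne'
  have hd : ∀ y, HasDerivAt
      (fun y => Complex.exp ((T : ℂ) * b * vgS a y) * vgF m k ν a T y / vgS a y)
      (Complex.I * T * (b * (Complex.exp ((T : ℂ) * b * vgS a y) * vgF m k ν a T y / vgS a y)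
        - Complex.exp ((T : ℂ) * b * vgS a y) * vgD m k ν a T y
        - 1 / T * (Complex.exp ((T : ℂ) * b * vgS a y) / vgS a y ^ 2))) y := by
    intro y
    have hs0 := vgS_ne a y ha
    have hQ0 := vgQ_ne m k a y hk hq
    have e1 := ((vgS_deriv a y).const_mul ((T : ℂ) * b)).cexp
    refine ((e1.mul (vgF_deriv m k ν a T y hk hq)).div (vgS_deriv a y) hs0).congr_deriv ?_
    unfold vgD
    push_cast
    simp only [Pi.mul_apply]
    field_simp
    ring
  have i12 := (i1.const_mul (b : ℂ)).sub i2
  have i123 := i12.sub (i3.const_mul (1 / (T : ℂ)))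
  have z := integral_eq_zero_of_hasDerivAt_of_integrable hd (i123.const_mul (Complex.I * T)) i1
  have inv : ∫ y, Complex.exp ((T : ℂ) * b * vgS a y) / vgS a y ^ 2 = 2 * Real.pi * (T * b) := by
    have := vg_inversion a (T * b) ha (by positivity)
    simpa [vgS] using this
  rw [integral_const_mul] at z
  have z' := (mul_eq_zero.1 z).resolve_left (mul_ne_zero Complex.I_ne_zero hT')
  have split := integral_sub i12 (i3.const_mul (1 / (T : ℂ)))
  have split2 := integral_sub (i1.const_mul (b : ℂ)) i2
  simp only [Pi.sub_apply] at split split2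
  rw [split, split2, integral_const_mul, integral_const_mul, inv] at z'
  have e : 1 / (T : ℂ) * (2 * Real.pi * (T * b)) = 2 * Real.pi * b := by field_simp
  rw [e] at z'
  linear_combination z'

lemma vg_q_pos (σ ν θ : ℝ) (hσ : 0 < σ) (hν : 0 < ν) (a : ℝ) (ha0 : 0 < a)
    (ha : a < (-(θ * ν) + Real.sqrt (2 * ν * σ ^ 2 + ν ^ 2 * θ ^ 2)) / (ν * σ ^ 2)) :
    0 < 1 - (θ * ν) * a - (σ ^ 2 * ν / 2) * a ^ 2 := by
  have hp : 0 < ν * σ ^ 2 := by positivity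
  rw [lt_div_iff₀ hp] at ha
  by_cases h : 0 ≤ a * (ν * σ ^ 2) + θ * ν
  · have h1 : (a * (ν * σ ^ 2) + θ * ν) ^ 2 < 2 * ν * σ ^ 2 + ν ^ 2 * θ ^ 2 := by
      rw [← Real.lt_sqrt h]
      linarith
    have h2 : 0 < (2 * (ν * σ ^ 2)) * (1 - (θ * ν) * a - (σ ^ 2 * ν / 2) * a ^ 2) := by nlinarith
    exact pos_of_mul_pos_right h2 (by positivity)
  · push Not at h
    nlinarith [mul_pos ha0 (neg_pos.2 h), mul_pos hp (mul_pos ha0 ha0)]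

/-- variance gamma model with positive drift `b > 0`: the ATM digital
price `P(T) = (1/(2π)) ∫ exp(Tb(a+iy)) Q(a+iy)^{−T/ν} / (a+iy) dy` tends to `1`
as `T → 0⁺`. -/
theorem variance_gamma_digital_positive_drift
    (σ ν θ b : ℝ) (hσ : 0 < σ) (hν : 0 < ν) (hb : 0 < b)
    (sp : ℝ) (hsp : sp = (-(θ * ν) + Real.sqrt (2 * ν * σ ^ 2 + ν ^ 2 * θ ^ 2)) / (ν * σ ^ 2))
    (a : ℝ) (ha : a ∈ Set.Ioo 0 sp)
    (P : ℝ → ℂ)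
    (hP : ∀ T : ℝ, 0 < T → P T = (1 / (2 * Real.pi) : ℂ) *
      ∫ y : ℝ, Complex.exp ((T : ℂ) * (b : ℂ) * ((a : ℂ) + y * Complex.I))
          * (1 - ((θ * ν : ℝ) : ℂ) * ((a : ℂ) + y * Complex.I)
            - ((σ ^ 2 * ν / 2 : ℝ) : ℂ) * ((a : ℂ) + y * Complex.I) ^ 2) ^ (-(T : ℂ) / (ν : ℂ))
        / ((a : ℂ) + y * Complex.I)) :
    Tendsto P (nhdsWithin 0 (Set.Ioi 0)) (nhds 1) := by
  obtain ⟨ha0, ha1⟩ := ha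
  rw [hsp] at ha1
  have hq := vg_q_pos σ ν θ hσ hν a ha0 ha1
  have hk : 0 < σ ^ 2 * ν / 2 := by positivity
  have hb' : (b : ℂ) ≠ 0 := by exact_mod_cast hb.ne'
  have hpi : (Real.pi : ℂ) ≠ 0 := by exact_mod_cast Real.pi_ne_zero
  have hlim := vg_remainder_tendsto (θ * ν) (σ ^ 2 * ν / 2) ν a b ha0 hν hk hb hq
  have hlim2 : Tendsto (fun T : ℝ => 1 + 1 / (2 * Real.pi * b : ℂ) *
      ∫ y, Complex.exp ((T : ℂ) * b * vgS a y) * vgD (θ * ν) (σ ^ 2 * ν / 2) ν a T y)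
      (nhdsWithin 0 (Set.Ioi 0)) (nhds 1) := by
    simpa using (hlim.const_mul (1 / (2 * Real.pi * b : ℂ))).const_add 1
  refine hlim2.congr' ?_
  filter_upwards [Ioc_mem_nhdsGT (show (0 : ℝ) < 1 by norm_num)] with T hT
  have hid := vg_identity (θ * ν) (σ ^ 2 * ν / 2) ν a b T ha0 hν hk hb hq hT.1 hT.2
  rw [hP T hT.1]
  have e : (∫ y : ℝ, Complex.exp ((T : ℂ) * (b : ℂ) * ((a : ℂ) + y * Complex.I))
          * (1 - ((θ * ν : ℝ) : ℂ) * ((a : ℂ) + y * Complex.I)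
            - ((σ ^ 2 * ν / 2 : ℝ) : ℂ) * ((a : ℂ) + y * Complex.I) ^ 2) ^ (-(T : ℂ) / (ν : ℂ))
        / ((a : ℂ) + y * Complex.I)) = ∫ y, Complex.exp ((T : ℂ) * b * vgS a y) *
          vgF (θ * ν) (σ ^ 2 * ν / 2) ν a T y / vgS a y := by
    congr 1 with y
    have : vgF (θ * ν) (σ ^ 2 * ν / 2) ν a T y =
        (vgQ (θ * ν) (σ ^ 2 * ν / 2) a y) ^ (-(T : ℂ) / (ν : ℂ)) := by
      rw [Complex.cpow_def_of_ne_zero (vgQ_ne _ _ a y hk hq), vgF]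
      congr 1
      push_cast
      ring
    rw [this]
    rfl
  rw [e]
  set X := ∫ y, Complex.exp ((T : ℂ) * b * vgS a y) *
          vgF (θ * ν) (σ ^ 2 * ν / 2) ν a T y / vgS a y
  set Y := ∫ y, Complex.exp ((T : ℂ) * b * vgS a y) * vgD (θ * ν) (σ ^ 2 * ν / 2) ν a T y
  have hX : X = (2 * Real.pi * b + Y) / b := by
    rw [← hid]; field_simp
  rw [hX]
  field_simp
end

section
/- Let δ > 0, b ≠ 0 real, α > 0, β real with |β| < α, and fix a ∈ (0, α − β). For T > 0 define P(T) = (1/(2π)) ∫_{−∞}^{∞} exp(T(b(a+iy) + δ(√(α² − β²) − √(α² − (β + a + iy)²)))) · (a+iy)⁻¹ dy, with the complex square root taken in the principal branch (the integral converges absolutely for every T > 0). Then lim_{T→0⁺} P(T) = 1/2 + (1/π)·arctan(b/δ). -/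
open MeasureTheory Filter

lemma nig_sqrt_re (z : ℂ) : 0 ≤ (z ^ ((1 : ℂ)/2)).re := by
  by_cases hz : z = 0
  · subst hz; simp
  rw [Complex.cpow_def_of_ne_zero hz, Complex.exp_re]
  refine mul_nonneg (Real.exp_pos _).le (Real.cos_nonneg_of_mem_Icc ?_)
  have h1 := Complex.neg_pi_lt_arg z
  have h2 := Complex.arg_le_pi z
  have : (Complex.log z * (1/2)).im = z.arg / 2 := by
    have : (Complex.log z * (1/2)) = Complex.log z / 2 := by ring
    rw [this]
    simp [Complex.log_im]
  rw [this]
  constructor <;> linarith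

lemma nig_sqrt_sq (z : ℂ) : (z ^ ((1 : ℂ)/2)) ^ 2 = z := by
  have := Complex.cpow_nat_inv_pow z (n := 2) (by norm_num)
  simpa using this

lemma nig_sqrt_bound (α c y : ℝ) :
    ‖((α : ℂ) ^ 2 - ((c : ℂ) + y * Complex.I) ^ 2) ^ ((1 : ℂ)/2) - (|y| : ℝ)‖
      ≤ |α ^ 2 - c ^ 2| + 2 * |c| + 3 := by
  set z : ℂ := (α : ℂ) ^ 2 - ((c : ℂ) + y * Complex.I) ^ 2 with hz
  have hre := nig_sqrt_re z
  have hsq := nig_sqrt_sq z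
  set w : ℂ := z ^ ((1 : ℂ)/2) with hw
  have hz2 : z - (y : ℂ)^2 = ((α ^ 2 - c ^ 2 : ℝ) : ℂ) - 2 * (c : ℂ) * y * Complex.I := by
    rw [hz]; push_cast
    linear_combination (-(y:ℂ)^2) * Complex.I_sq
  have hn : ‖z - (y : ℂ)^2‖ ≤ |α ^ 2 - c ^ 2| + 2 * |c| * |y| := by
    rw [hz2]
    refine (norm_sub_le _ _).trans ?_
    rw [Complex.norm_real]
    simp [abs_mul]
  have hy2 : ((|y| : ℝ) : ℂ) ^ 2 = (y : ℂ) ^ 2 := by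
    rw [← Complex.ofReal_pow, sq_abs, Complex.ofReal_pow]
  have hA := abs_nonneg (α ^ 2 - c ^ 2)
  have hc := abs_nonneg c
  have hy := abs_nonneg y
  rcases le_total 1 |y| with h | h
  · have hprod : (w - (|y| : ℝ)) * (w + (|y| : ℝ)) = z - (y : ℂ)^2 := by
      rw [← hy2, ← hsq]; ring
    have hlow : |y| ≤ ‖w + (|y| : ℝ)‖ := by
      refine le_trans ?_ (Complex.re_le_norm _)
      simp [hre]
    have hmul : ‖w - (|y| : ℝ)‖ * |y| ≤ (|α ^ 2 - c ^ 2| + 2 * |c|) * |y| := by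
      calc _ ≤ ‖w - (|y| : ℝ)‖ * ‖w + (|y| : ℝ)‖ := by gcongr
        _ = ‖z - (y : ℂ)^2‖ := by rw [← norm_mul, hprod]
        _ ≤ _ := hn
        _ ≤ _ := by nlinarith
    have := le_of_mul_le_mul_right hmul (by linarith)
    linarith
  · have hzn : ‖z‖ ≤ |α ^ 2 - c ^ 2| + 2 * |c| + 1 := by
      have h3 : z = (z - (y : ℂ)^2) + (y : ℂ)^2 := by ring
      rw [h3]
      refine (norm_add_le _ _).trans ?_
      have h4 : ‖(y : ℂ)^2‖ ≤ 1 := by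
        rw [norm_pow, Complex.norm_real, Real.norm_eq_abs]
        nlinarith
      nlinarith
    have hw2 : ‖w‖ ^ 2 = ‖z‖ := by rw [← norm_pow, hsq]
    have hw1 : ‖w‖ ≤ ‖z‖ + 1 := by nlinarith [sq_nonneg (‖w‖ - 1)]
    refine (norm_sub_le _ _).trans ?_
    rw [Complex.norm_real, Real.norm_eq_abs, abs_abs]
    linarith

lemma nig_exp_abs_integrable {δ : ℝ} (hδ : 0 < δ) :
    Integrable (fun u : ℝ => Real.exp (-δ * |u|)) := by
  rw [← integrableOn_univ, ← Set.Iic_union_Ioi (a := (0:ℝ)), integrableOn_union]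
  constructor
  · refine (integrableOn_exp_mul_Iic hδ 0).congr_fun (fun x hx => ?_) measurableSet_Iic
    simp [abs_of_nonpos (Set.mem_Iic.1 hx)]
  · refine (integrableOn_exp_mul_Ioi (neg_lt_zero.2 hδ) 0).congr_fun (fun x hx => ?_)
      measurableSet_Ioi
    simp [abs_of_pos (Set.mem_Ioi.1 hx)]

/-- the comparison exponent -/
noncomputable def nigE (b δ u : ℝ) : ℂ := (b : ℂ) * u * Complex.I - (δ : ℂ) * (|u| : ℝ)

lemma nigE_norm (b δ u : ℝ) : ‖Complex.exp (nigE b δ u)‖ = Real.exp (-δ * |u|) := by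
  rw [Complex.norm_exp]; simp [nigE]

lemma nigE_cont (b δ : ℝ) : Continuous (nigE b δ) := by
  unfold nigE; fun_prop

lemma nigE_integrable (b : ℝ) {δ : ℝ} (hδ : 0 < δ) :
    Integrable (fun u : ℝ => Complex.exp (nigE b δ u)) := by
  refine (nig_exp_abs_integrable hδ).mono' ?_ ?_
  · exact (Complex.continuous_exp.comp (nigE_cont b δ)).aestronglyMeasurable
  · exact ae_of_all _ fun u => (nigE_norm b δ u).le

lemma nigE_integral (k : ℝ) {δ : ℝ} (hδ : 0 < δ) :
    ∫ u : ℝ, Complex.exp (nigE k δ u) = ((2 * δ / (δ ^ 2 + k ^ 2) : ℝ) : ℂ) := by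
  have hi := nigE_integrable k hδ
  rw [← intervalIntegral.integral_Iic_add_Ioi (b := 0) hi.integrableOn hi.integrableOn]
  have h1 : ∫ u in Set.Iic (0:ℝ), Complex.exp (nigE k δ u)
      = ∫ u : ℝ in Set.Iic (0:ℝ), Complex.exp (((δ : ℂ) + k * Complex.I) * u) := by
    refine setIntegral_congr_fun measurableSet_Iic fun x hx => ?_
    simp only [nigE, abs_of_nonpos (Set.mem_Iic.1 hx)]
    congr 1; push_cast; ring
  have h2 : ∫ u in Set.Ioi (0:ℝ), Complex.exp (nigE k δ u)
      = ∫ u : ℝ in Set.Ioi (0:ℝ), Complex.exp ((-(δ : ℂ) + k * Complex.I) * u) := by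
    refine setIntegral_congr_fun measurableSet_Ioi fun x hx => ?_
    simp only [nigE, abs_of_pos (Set.mem_Ioi.1 hx)]
    congr 1; push_cast; ring
  rw [h1, h2, integral_exp_mul_complex_Iic (by simpa using hδ),
    integral_exp_mul_complex_Ioi (by simpa using hδ)]
  have n1 : (δ : ℂ) + k * Complex.I ≠ 0 := by
    intro h; have := congrArg Complex.re h; simp at this; exact hδ.ne' this
  have n2 : -(δ : ℂ) + k * Complex.I ≠ 0 := by
    intro h; have := congrArg Complex.re h; simp at this; exact hδ.ne' this
  have n3 : (δ : ℂ) ^ 2 + (k : ℂ) ^ 2 ≠ 0 := by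
    have : δ ^ 2 + k ^ 2 ≠ 0 := by positivity
    exact_mod_cast this
  push_cast
  simp only [mul_zero, Complex.exp_zero]
  rw [div_add_div _ _ n1 n2, div_eq_div_iff (mul_ne_zero n1 n2) n3]
  linear_combination (-2 * (δ:ℂ) * (k:ℂ)^2) * Complex.I_sq

lemma nig_main_eq (b : ℝ) {δ ε : ℝ} (hδ : 0 < δ) (hε : 0 < ε) :
    ∫ u : ℝ, Complex.exp (nigE b δ u) / ((ε : ℂ) + u * Complex.I)
      = ((∫ x in Set.Ioi (0:ℝ), Real.exp (-ε * x) * (2 * δ / (δ ^ 2 + (b - x) ^ 2)) : ℝ) : ℂ) := by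
  have hL : ∀ u : ℝ, Complex.exp (nigE b δ u) / ((ε : ℂ) + u * Complex.I)
      = ∫ x in Set.Ioi (0:ℝ),
        Complex.exp (nigE b δ u) * Complex.exp (-((ε : ℂ) + u * Complex.I) * x) := by
    intro u
    rw [integral_const_mul, integral_exp_mul_complex_Ioi (by simpa using hε)]
    rw [Complex.ofReal_zero, mul_zero, Complex.exp_zero, neg_div_neg_eq, mul_one_div]
  simp_rw [hL]
  rw [integral_integral_swap]
  · rw [← integral_complex_ofReal]
    refine integral_congr_ae (ae_of_all _ fun x => ?_)
    simp only
    rw [Complex.ofReal_mul, ← nigE_integral (b - x) hδ, ← integral_const_mul]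
    congr 1; ext u
    rw [← Complex.exp_add, Complex.ofReal_exp, ← Complex.exp_add]
    congr 1; simp only [nigE]; push_cast; ring
  · have hp : Integrable (fun p : ℝ × ℝ => Real.exp (-δ * |p.1|) * Real.exp (-ε * p.2))
        (volume.prod (volume.restrict (Set.Ioi (0:ℝ)))) :=
      (nig_exp_abs_integrable hδ).mul_prod (integrableOn_exp_mul_Ioi (neg_lt_zero.2 hε) 0)
    refine hp.mono' ?_ (ae_of_all _ fun p => ?_)
    · refine Continuous.aestronglyMeasurable ?_
      have := nigE_cont b δ
      simp only [Function.uncurry_def]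
      fun_prop
    · simp only [Function.uncurry_def]
      rw [norm_mul, nigE_norm, Complex.norm_exp]
      simp

lemma nig_cauchy_deriv (b : ℝ) {δ : ℝ} (hδ : 0 < δ) (x : ℝ) :
    HasDerivAt (fun x => 2 * Real.arctan ((x - b) / δ)) (2 * δ / (δ ^ 2 + (b - x) ^ 2)) x := by
  have h := ((((hasDerivAt_id x).sub_const b).div_const δ).arctan).const_mul 2
  refine h.congr_deriv ?_
  simp only [id]
  have : δ ^ 2 + (b - x) ^ 2 ≠ 0 := by positivity
  have : δ ^ 2 + (x - b) ^ 2 ≠ 0 := by positivity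
  field_simp
  ring

lemma nig_cauchy_tendsto (b : ℝ) {δ : ℝ} (hδ : 0 < δ) :
    Tendsto (fun x => 2 * Real.arctan ((x - b) / δ)) atTop (nhds (2 * (Real.pi / 2))) := by
  refine Tendsto.const_mul 2 ?_
  refine (tendsto_nhds_of_tendsto_nhdsWithin Real.tendsto_arctan_atTop).comp ?_
  exact (tendsto_atTop_add_const_right _ (-b) tendsto_id).atTop_div_const hδ

lemma nig_main_tendsto (b : ℝ) {δ a : ℝ} (hδ : 0 < δ) (ha : 0 < a) :
    Tendsto (fun T : ℝ => ∫ u : ℝ, Complex.exp (nigE b δ u) / (((a * T : ℝ) : ℂ) + u * Complex.I))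
      (nhdsWithin 0 (Set.Ioi 0))
      (nhds ((Real.pi + 2 * Real.arctan (b / δ) : ℝ) : ℂ)) := by
  have hval : ∫ x in Set.Ioi (0:ℝ), (2 * δ / (δ ^ 2 + (b - x) ^ 2))
      = Real.pi + 2 * Real.arctan (b / δ) := by
    rw [integral_Ioi_of_hasDerivAt_of_nonneg' (fun x _ => nig_cauchy_deriv b hδ x)
      (fun x _ => by positivity) (nig_cauchy_tendsto b hδ)]
    rw [zero_sub, neg_div, Real.arctan_neg]; ring
  have hint : IntegrableOn (fun x => (2 * δ / (δ ^ 2 + (b - x) ^ 2))) (Set.Ioi (0:ℝ)) :=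
    integrableOn_Ioi_deriv_of_nonneg' (fun x _ => nig_cauchy_deriv b hδ x)
      (fun x _ => by positivity) (nig_cauchy_tendsto b hδ)
  have hR : Tendsto (fun T : ℝ => ∫ x in Set.Ioi (0:ℝ),
      Real.exp (-(a * T) * x) * (2 * δ / (δ ^ 2 + (b - x) ^ 2)))
      (nhdsWithin 0 (Set.Ioi 0)) (nhds (Real.pi + 2 * Real.arctan (b / δ))) := by
    rw [← hval]
    refine tendsto_integral_filter_of_dominated_convergence _ ?_ ?_ hint ?_
    · refine Eventually.of_forall fun T => ?_
      exact (Continuous.aestronglyMeasurable (by fun_prop)).mul hint.aestronglyMeasurable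
    · filter_upwards [self_mem_nhdsWithin] with T hT
      filter_upwards [ae_restrict_mem measurableSet_Ioi] with x hx
      have hT' : 0 < T := hT
      have hx' : 0 < x := hx
      have hq : 0 ≤ 2 * δ / (δ ^ 2 + (b - x) ^ 2) := by positivity
      rw [norm_mul, Real.norm_of_nonneg hq, Real.norm_of_nonneg (Real.exp_pos _).le]
      refine mul_le_of_le_one_left hq (Real.exp_le_one_iff.2 ?_)
      have : 0 < a * T * x := by positivity
      linarith
    · refine ae_of_all _ fun x => ?_
      have hc : Continuous fun T : ℝ =>
        Real.exp (-(a * T) * x) * (2 * δ / (δ ^ 2 + (b - x) ^ 2)) := by fun_prop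
      have := hc.tendsto 0
      simp only [mul_zero, neg_zero, zero_mul, Real.exp_zero, one_mul] at this
      exact this.mono_left nhdsWithin_le_nhds
  refine ((Complex.continuous_ofReal.tendsto _).comp hR).congr' ?_
  filter_upwards [self_mem_nhdsWithin] with T hT
  exact (nig_main_eq b hδ (mul_pos ha hT)).symm

lemma nig_general (b C : ℝ) {δ a : ℝ} (hδ : 0 < δ) (ha : 0 < a) (ψ : ℝ → ℂ) (hψ : Measurable ψ)
    (hC : ∀ y, ‖ψ y - nigE b δ y‖ ≤ C) :
    Tendsto (fun T : ℝ => ∫ y : ℝ, Complex.exp ((T : ℂ) * ψ y) / ((a : ℂ) + y * Complex.I))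
      (nhdsWithin 0 (Set.Ioi 0))
      (nhds ((Real.pi + 2 * Real.arctan (b / δ) : ℝ) : ℂ)) := by
  have hC0 : 0 ≤ C := (norm_nonneg _).trans (hC 0)
  let D : ℝ → ℝ → ℂ := fun T u =>
    (Complex.exp ((T : ℂ) * ψ (u / T)) - Complex.exp (nigE b δ u))
      / (((a * T : ℝ) : ℂ) + u * Complex.I)
  have hDm : ∀ T, AEStronglyMeasurable (D T) volume := by
    intro T
    have h1 := (nigE_cont b δ).measurable
    have : Measurable (D T) := by
      simp only [D]
      fun_prop
    exact this.aestronglyMeasurable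
  have hnum : ∀ T : ℝ, 0 < T → T ≤ 1 → ∀ u : ℝ,
      ‖Complex.exp ((T : ℂ) * ψ (u / T)) - Complex.exp (nigE b δ u)‖
        ≤ T * (C * Real.exp C) * Real.exp (-δ * |u|) := by
    intro T hT hT1 u
    have hE : nigE b δ u = (T : ℂ) * nigE b δ (u / T) := by
      have : (T : ℂ) ≠ 0 := by exact_mod_cast hT.ne'
      simp only [nigE, abs_div, abs_of_pos hT]
      push_cast
      field_simp
    set x : ℂ := (T : ℂ) * ψ (u / T) - nigE b δ u with hx
    have hxn : ‖x‖ ≤ T * C := by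
      rw [hx, hE, ← mul_sub, norm_mul, Complex.norm_real, Real.norm_of_nonneg hT.le]
      exact mul_le_mul_of_nonneg_left (hC _) hT.le
    have h1 : Complex.exp ((T : ℂ) * ψ (u / T)) - Complex.exp (nigE b δ u)
        = Complex.exp (nigE b δ u) * (Complex.exp x - 1) := by
      rw [mul_sub, ← Complex.exp_add, hx]; ring_nf
    have h2 : ‖Complex.exp x - 1‖ ≤ ‖x‖ * Real.exp ‖x‖ := by
      simpa using Complex.norm_exp_sub_sum_le_norm_mul_exp x 1
    rw [h1, norm_mul, nigE_norm, mul_comm]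
    refine mul_le_mul_of_nonneg_right (h2.trans ?_) (Real.exp_pos _).le
    rw [← mul_assoc]
    have : ‖x‖ ≤ C := hxn.trans (by nlinarith)
    gcongr
  have hden1 : ∀ T : ℝ, 0 < T → ∀ u : ℝ, a * T ≤ ‖((a * T : ℝ) : ℂ) + u * Complex.I‖ := by
    intro T hT u
    refine le_trans ?_ (Complex.re_le_norm _)
    simp
  have hden2 : ∀ T : ℝ, ∀ u : ℝ, |u| ≤ ‖((a * T : ℝ) : ℂ) + u * Complex.I‖ := by
    intro T u
    refine le_trans ?_ (Complex.abs_im_le_norm _)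
    simp
  have hDb : ∀ T : ℝ, 0 < T → T ≤ 1 → ∀ u : ℝ,
      ‖D T u‖ ≤ C * Real.exp C / a * Real.exp (-δ * |u|) := by
    intro T hT hT1 u
    simp only [D]
    rw [norm_div]
    have haT : 0 < a * T := mul_pos ha hT
    calc _ ≤ (T * (C * Real.exp C) * Real.exp (-δ * |u|)) / (a * T) :=
          div_le_div₀ (by positivity) (hnum T hT hT1 u) haT (hden1 T hT u)
      _ = _ := by field_simp
  have hbi : Integrable (fun u : ℝ => C * Real.exp C / a * Real.exp (-δ * |u|)) :=
    (nig_exp_abs_integrable hδ).const_mul _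
  have hev : ∀ᶠ T : ℝ in nhdsWithin 0 (Set.Ioi 0), 0 < T ∧ T ≤ 1 := by
    filter_upwards [Ioc_mem_nhdsGT (zero_lt_one' ℝ)] with T hT using hT
  have hD0 : Tendsto (fun T : ℝ => ∫ u, D T u) (nhdsWithin 0 (Set.Ioi 0)) (nhds 0) := by
    have : Tendsto (fun T : ℝ => ∫ u, D T u) (nhdsWithin 0 (Set.Ioi 0))
        (nhds (∫ _u : ℝ, (0:ℂ))) := by
      refine tendsto_integral_filter_of_dominated_convergence _ (Eventually.of_forall hDm) ?_ hbi ?_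
      · filter_upwards [hev] with T hT
        exact ae_of_all _ (hDb T hT.1 hT.2)
      · have h0 : ∀ᵐ u : ℝ, u ≠ 0 := by simp [ae_iff]
        filter_upwards [h0] with u hu
        have hlim : Tendsto (fun T : ℝ => T * (C * Real.exp C) * Real.exp (-δ * |u|) / |u|)
            (nhdsWithin 0 (Set.Ioi 0)) (nhds 0) := by
          have hc : Continuous fun T : ℝ =>
            T * (C * Real.exp C) * Real.exp (-δ * |u|) / |u| := by fun_prop
          have := hc.tendsto 0
          simp only [zero_mul, zero_div] at this
          exact this.mono_left nhdsWithin_le_nhds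
        refine squeeze_zero_norm' ?_ hlim
        filter_upwards [hev] with T hT
        simp only [D]
        rw [norm_div]
        have hT0 := hT.1
        exact div_le_div₀ (by positivity) (hnum T hT.1 hT.2 u) (abs_pos.2 hu) (hden2 T u)
    simpa using this
  have hsum := hD0.add (nig_main_tendsto b hδ ha)
  rw [zero_add] at hsum
  refine hsum.congr' ?_
  filter_upwards [hev] with T hT
  obtain ⟨hT, hT1⟩ := hT
  have haT : 0 < a * T := mul_pos ha hT
  have hDi : Integrable (D T) := hbi.mono' (hDm T) (ae_of_all _ (hDb T hT hT1))
  have hGi : Integrable (fun u : ℝ =>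
      Complex.exp (nigE b δ u) / (((a * T : ℝ) : ℂ) + u * Complex.I)) := by
    refine ((nig_exp_abs_integrable hδ).div_const (a * T)).mono' ?_ (ae_of_all _ fun u => ?_)
    · have h1 := (nigE_cont b δ).measurable
      exact Measurable.aestronglyMeasurable (by fun_prop)
    · rw [norm_div, nigE_norm]
      exact div_le_div_of_nonneg_left (Real.exp_pos _).le haT (hden1 T hT u)
  rw [← integral_add hDi hGi]
  have hTc : (T : ℂ) ≠ 0 := by exact_mod_cast hT.ne'
  have hsub := Measure.integral_comp_div
    (fun y : ℝ => Complex.exp ((T : ℂ) * ψ y) / ((a : ℂ) + y * Complex.I)) T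
  rw [abs_of_pos hT] at hsub
  have hsub' : ∫ y : ℝ, Complex.exp ((T : ℂ) * ψ y) / ((a : ℂ) + y * Complex.I)
      = (T:ℂ)⁻¹ * ∫ u : ℝ, Complex.exp ((T : ℂ) * ψ (u / T)) /
        ((a : ℂ) + ((u / T : ℝ) : ℂ) * Complex.I) := by
    rw [hsub, Complex.real_smul, inv_mul_cancel_left₀ hTc]
  rw [hsub', ← integral_const_mul]
  congr 1; ext u
  simp only [D]
  rw [← add_div, sub_add_cancel]
  have : ((a * T : ℝ) : ℂ) + u * Complex.I
      = T * ((a : ℂ) + ((u / T : ℝ) : ℂ) * Complex.I) := by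
    push_cast; field_simp
  rw [this, div_eq_mul_inv, mul_inv, div_eq_mul_inv]; ring

/-- NIG model with drift `b ≠ 0`: the ATM digital price
`P(T) = (1/(2π)) ∫ exp(T(b(a+iy) + δ(√(α²−β²) − √(α²−(β+a+iy)²)))) / (a+iy) dy`
(principal branch square roots) tends to `1/2 + (1/π) arctan(b/δ)` as `T → 0⁺`. -/
theorem nig_digital_limit
    (δ b α β a : ℝ) (hδ : 0 < δ) (hb : b ≠ 0) (hα : 0 < α) (hβ : |β| < α)
    (ha : a ∈ Set.Ioo 0 (α - β))
    (P : ℝ → ℂ)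
    (hP : ∀ T : ℝ, 0 < T → P T = (1 / (2 * Real.pi) : ℂ) *
      ∫ y : ℝ, Complex.exp ((T : ℂ) * ((b : ℂ) * ((a : ℂ) + y * Complex.I)
          + (δ : ℂ) * (((α : ℂ) ^ 2 - (β : ℂ) ^ 2) ^ ((1 : ℂ)/2)
            - ((α : ℂ) ^ 2 - ((β : ℂ) + (a : ℂ) + y * Complex.I) ^ 2) ^ ((1 : ℂ)/2))))
        / ((a : ℂ) + y * Complex.I)) :
    Tendsto P (nhdsWithin 0 (Set.Ioi 0))
      (nhds ((1/2 + (1 / Real.pi) * Real.arctan (b / δ) : ℝ) : ℂ)) := by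

  set c : ℝ := β + a with hc
  set ψ : ℝ → ℂ := fun y => (b : ℂ) * ((a : ℂ) + y * Complex.I)
          + (δ : ℂ) * (((α : ℂ) ^ 2 - (β : ℂ) ^ 2) ^ ((1 : ℂ)/2)
            - ((α : ℂ) ^ 2 - ((β : ℂ) + (a : ℂ) + y * Complex.I) ^ 2) ^ ((1 : ℂ)/2)) with hψ
  have hm : Measurable ψ := by
    rw [hψ]; fun_prop
  have hbound : ∀ y, ‖ψ y - nigE b δ y‖ ≤
      ‖(b : ℂ) * a + (δ : ℂ) * ((α : ℂ) ^ 2 - (β : ℂ) ^ 2) ^ ((1 : ℂ)/2)‖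
        + δ * (|α ^ 2 - c ^ 2| + 2 * |c| + 3) := by
    intro y
    have hs := nig_sqrt_bound α c y
    have he : ψ y - nigE b δ y =
      ((b : ℂ) * a + (δ : ℂ) * ((α : ℂ) ^ 2 - (β : ℂ) ^ 2) ^ ((1 : ℂ)/2))
      - (δ : ℂ) * (((α : ℂ) ^ 2 - ((c : ℂ) + y * Complex.I) ^ 2) ^ ((1 : ℂ)/2)
        - (|y| : ℝ)) := by
      simp only [hψ, nigE, hc, Complex.ofReal_add]
      ring
    rw [he]
    refine (norm_sub_le _ _).trans ?_
    rw [norm_mul (δ : ℂ), Complex.norm_real, Real.norm_of_nonneg hδ.le]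
    gcongr
  have h := (nig_general b _ hδ ha.1 ψ hm hbound).const_mul (1 / (2 * Real.pi) : ℂ)
  have hv : (1 / (2 * Real.pi) : ℂ) * ((Real.pi + 2 * Real.arctan (b / δ) : ℝ) : ℂ)
      = ((1/2 + (1 / Real.pi) * Real.arctan (b / δ) : ℝ) : ℂ) := by
    have : (Real.pi : ℂ) ≠ 0 := by exact_mod_cast Real.pi_ne_zero
    push_cast
    field_simp
  rw [hv] at h
  refine h.congr' ?_
  filter_upwards [self_mem_nhdsWithin] with T hT
  exact (hP T hT).symm
end
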